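/- Let d = 4. There exists C < ∞ such that for all sufficiently large T ∈ ℕ and all integers t with 2T·log^{-10}T < t < T − 2T·log^{-10}T, setting t' = ⌊T·log^{-10}T⌋: if (X¹_s)_{s∈ℤ} is a doubly infinite simple random walk with X¹_0 = 𝟎 and (X²_s)_{s≥0} is an independent simple random walk from 𝟎, then P[ X¹[−t, T−t] ∩ X²(0,t'] = ∅ and X¹[−t, T−t] ∩ X²[t',∞) ≠ ∅ ] ≤ C·log^{-3/2}T, where X¹[−t, T−t] = {X¹_s : −t ≤ s ≤ T−t}, X²(0,t'] = {X²_s : 1 ≤ s ≤ t'}, and X²[t',∞) = {X²_s : s ≥ t'}. -/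

import Mathlib

open MeasureTheory ProbabilityTheory Filter Topology
open scoped ENNReal NNReal Classical

noncomputable section

namespace FRIPaper

/-- The lattice `ℤ^d`. -/
abbrev Zd (d : ℕ) := Fin d → ℤ

/-- `x` and `y` are nearest neighbours in `ℤ^d` (`ℓ¹`-distance one). -/
def IsNN {d : ℕ} (x y : Zd d) : Prop := (∑ i, (x i - y i).natAbs) = 1

/-- Event that a one-sided path never visits `A` at a positive time
(i.e. `H̃_A = ∞` for the path started anywhere). -/
def NoReturn {d : ℕ} (A : Set (Zd d)) : Set (ℕ → Zd d) := {ω | ∀ t : ℕ, 0 < t → ω t ∉ A}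

/-- Event that a one-sided path does not visit `A` at a positive time `t ≤ s`
(i.e. `H̃_A > s`). -/
def NoReturnUpTo {d : ℕ} (A : Set (Zd d)) (s : ℝ) : Set (ℕ → Zd d) :=
  {ω | ∀ t : ℕ, 0 < t → (t : ℝ) ≤ s → ω t ∉ A}

/-- Specification of the law `P^x` of the discrete-time simple random walk on `ℤ^d`
started at `x`, as a measure on the path space `ℕ → ℤ^d`: it is the unique probability
measure giving each nearest-neighbour cylinder of length `T` based at `x`
probability `(2d)^{-T}`. -/
def IsSRW (d : ℕ) (x : Zd d) (P : Measure (ℕ → Zd d)) : Prop :=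
  IsProbabilityMeasure P ∧
    ∀ (T : ℕ) (w : ℕ → Zd d),
      P {ω | ∀ t ≤ T, ω t = w t} =
        if w 0 = x ∧ ∀ t < T, IsNN (w t) (w (t + 1)) then
          (((2 * d : ℕ) : ℝ≥0∞))⁻¹ ^ T else 0

/-- A family `P x`, `x ∈ ℤ^d`, of simple random walk laws. -/
def IsSRWFamily (d : ℕ) (P : Zd d → Measure (ℕ → Zd d)) : Prop := ∀ x, IsSRW d x (P x)

/-- Equilibrium measure `e_A(x) = P^x[H̃_A = ∞] 1_{x ∈ A}`. -/
def equil {d : ℕ} (P : Zd d → Measure (ℕ → Zd d)) (A : Set (Zd d)) (x : Zd d) : ℝ :=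
  if x ∈ A then (P x (NoReturn A)).toReal else 0

/-- Capacity `cap(A) = Σ_{x∈A} e_A(x)`. -/
def capacity {d : ℕ} (P : Zd d → Measure (ℕ → Zd d)) (A : Finset (Zd d)) : ℝ :=
  ∑ x ∈ A, equil P (↑A) x

/-- Truncated capacity `cap(A,T) = Σ_{x∈A} P^x[H̃_A > T·(log T)^{-10}]`. -/
def capTrunc {d : ℕ} (P : Zd d → Measure (ℕ → Zd d)) (A : Finset (Zd d)) (T : ℝ) : ℝ :=
  ∑ x ∈ A, (P x (NoReturnUpTo (↑A) (T / (Real.log T) ^ (10 : ℕ)))).toReal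

/-- `X[a,b]`, the set of points visited by the path between times `a` and `b`. -/
def walkRange {d : ℕ} (ω : ℕ → Zd d) (a b : ℕ) : Finset (Zd d) := (Finset.Icc a b).image ω

/-- `E^0[cap(X[0,T])]`. -/
def capExpect {d : ℕ} (P : Zd d → Measure (ℕ → Zd d)) (T : ℕ) : ℝ :=
  ∫ ω, capacity P (walkRange ω 0 T) ∂ (P 0)

/-- `1 + log x · 1_{d = 4}`. -/
def logFour (d : ℕ) (x : ℝ) : ℝ := 1 + if d = 4 then Real.log x else 0

/-- `ε` is the constant `ε_d = lim_{T→∞} E^0[cap(X[0,T])]·T^{-1}·(1 + log T·1_{d=4})`,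
which lies in `(0,∞)`. -/
def IsCapLimit (d : ℕ) (P : Zd d → Measure (ℕ → Zd d)) (ε : ℝ) : Prop :=
  0 < ε ∧ Tendsto (fun T : ℕ => capExpect P T * logFour d T / (T : ℝ)) atTop (𝓝 ε)

/-! ### Distributions on `ℕ` -/

/-- `ρ` is a probability distribution on `ℕ`. -/
def IsDist (ρ : ℕ → ℝ) : Prop := (∀ k, 0 ≤ ρ k) ∧ HasSum ρ 1

/-- `k`-th moment `μ_k(ρ)`. -/
def mu (k : ℕ) (ρ : ℕ → ℝ) : ℝ := ∑' l : ℕ, (l : ℝ) ^ k * ρ l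

/-- Tail `μ_k^{(m)}(ρ) = Σ_{l ≥ m} l^k ρ(l)`. -/
def muTail (k m : ℕ) (ρ : ℕ → ℝ) : ℝ := ∑' l : ℕ, if m ≤ l then (l : ℝ) ^ k * ρ l else 0

/-- An appropriate family of distributions on `ℕ`. -/
def Appropriate (ρ : ℕ → ℕ → ℝ) : Prop :=
  (∀ n, IsDist (ρ n)) ∧
  (∀ n, Summable fun l : ℕ => (l : ℝ) ^ 2 * ρ n l) ∧
  Tendsto (fun n => mu 1 (ρ n)) atTop atTop ∧
  ∀ ε : ℝ, 0 < ε → ∃ C : ℝ,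
    ∀ n, (∑' L : ℕ, if C * mu 1 (ρ n) ≤ (L : ℝ) then (L : ℝ) ^ 2 * ρ n L / mu 2 (ρ n) else 0) ≤ ε

/-- Geometric distribution `Geo(λ)(k) = λ (1-λ)^k`. -/
def geo (lam : ℝ) (k : ℕ) : ℝ := lam * (1 - lam) ^ k

/-! ### Trajectories and finitary random interlacements -/

/-- A finite trajectory in `ℤ^d`, recorded as the list of its positions. -/
abbrev Traj (d : ℕ) := List (Zd d)

/-- A point configuration: the multiplicity of each trajectory. -/
abbrev Config (d : ℕ) := Traj d → ℕ

/-- A valid trajectory: a nonempty nearest-neighbour path. -/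
def ValidTraj {d : ℕ} (η : Traj d) : Prop := η ≠ [] ∧ η.Chain' IsNN

/-- The time length `T(η)` of a trajectory. -/
def len {d : ℕ} (η : Traj d) : ℕ := η.length - 1

/-- The range of a trajectory, as a set. -/
def rangeSet {d : ℕ} (η : Traj d) : Set (Zd d) := {y | y ∈ η}

/-- The trajectory `η` visits the set `A`. -/
def hits {d : ℕ} (η : Traj d) (A : Set (Zd d)) : Prop := ∃ y ∈ η, y ∈ A

/-- Poisson probability mass `e^{-r} r^n / n!`. -/
def poissonProb (r : ℝ) (n : ℕ) : ℝ≥0∞ :=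
  ENNReal.ofReal (Real.exp (-r) * r ^ n / n.factorial)

/-- The intensity `u·π({η})` that FRI with parameters `(u,ρ)` puts on a single
trajectory `η`: trajectories of length `l` from each starting point carry mass
`u·ρ(l)/(μ₁(ρ)+1)·(2d)^{-l}` each. -/
def friIntensity (d : ℕ) (u : ℝ) (ρ : ℕ → ℝ) (η : Traj d) : ℝ :=
  if ValidTraj η then u * ρ (len η) / (mu 1 ρ + 1) * (1 / (2 * (d : ℝ))) ^ (len η) else 0

/-- `P` is the law of a Poisson point process on the countable set of trajectories
with intensity function `ι`: the multiplicities of distinct trajectories are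
independent Poisson random variables. -/
def IsPoissonPP (d : ℕ) (ι : Traj d → ℝ) (P : Measure (Config d)) : Prop :=
  IsProbabilityMeasure P ∧
    ∀ (F : Finset (Traj d)) (k : Traj d → ℕ),
      P {ω | ∀ η ∈ F, ω η = k η} = ∏ η ∈ F, poissonProb (ι η) (k η)

/-- `P` is the law of the finitary random interlacements point process `𝒳^{u,ρ}`. -/
def IsFRI (d : ℕ) (u : ℝ) (ρ : ℕ → ℝ) (P : Measure (Config d)) : Prop :=
  IsPoissonPP d (friIntensity d u ρ) P

/-- `J` is the law of an i.i.d. sequence of copies of `𝒳^{u,ρ}`. -/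
def IsFRIseq (d : ℕ) (u : ℝ) (ρ : ℕ → ℝ) (J : Measure (ℕ → Config d)) : Prop :=
  IsProbabilityMeasure J ∧
    ∀ (F : Finset (ℕ × Traj d)) (k : ℕ × Traj d → ℕ),
      J {j | ∀ p ∈ F, j p.1 p.2 = k p} = ∏ p ∈ F, poissonProb (friIntensity d u ρ p.2) (k p)

/-! ### Percolation -/

/-- The edge `{x,y}` is traversed by some trajectory of the configuration `ω`. -/
def EdgeOpen {d : ℕ} (ω : Config d) (x y : Zd d) : Prop :=
  ∃ η : Traj d, 0 < ω η ∧ ∃ i : ℕ,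
    (η[i]? = some x ∧ η[i + 1]? = some y) ∨ (η[i]? = some y ∧ η[i + 1]? = some x)

/-- The cluster of `x` in the subgraph `ℐ` induced by the configuration `ω`. -/
def Cluster {d : ℕ} (ω : Config d) (x : Zd d) : Set (Zd d) :=
  {y | Relation.ReflTransGen (EdgeOpen ω) x y}

/-- The origin lies in an infinite cluster. -/
def PercEvent (d : ℕ) : Set (Config d) := {ω | (Cluster ω 0).Infinite}

/-- The critical intensity `u_*(ρ)`, given the family `u ↦ 𝒳^{u,ρ}`. -/
def uStar (d : ℕ) (X : ℝ → Measure (Config d)) : ℝ :=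
  sInf {u : ℝ | 0 ≤ u ∧ 0 < X u (PercEvent d)}

/-- The order `u_n = μ₁(ρ)·(1 + log μ₁(ρ)·1_{d=4}) / (ε_d·μ₂(ρ))` of the
critical intensity. -/
def uN (d : ℕ) (εd : ℝ) (ρ : ℕ → ℝ) : ℝ :=
  mu 1 ρ * logFour d (mu 1 ρ) / (εd * mu 2 ρ)

/-! ### `ρ`-capacity, Green function, `κ` and `φ` -/

/-- `e_A^{(ρ)}(x) = Σ_m (μ₀^{(m)}(ρ)/(μ₁(ρ)+1))·P^x[H̃_A > m]`. -/
def equilRho {d : ℕ} (P : Zd d → Measure (ℕ → Zd d)) (ρ : ℕ → ℝ) (A : Set (Zd d))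
    (x : Zd d) : ℝ :=
  ∑' m : ℕ, (muTail 0 m ρ / (mu 1 ρ + 1)) * (P x (NoReturnUpTo A (m : ℝ))).toReal

/-- `cap^{(ρ)}(A) = Σ_{x∈A} e_A^{(ρ)}(x)`. -/
def capRho {d : ℕ} (P : Zd d → Measure (ℕ → Zd d)) (ρ : ℕ → ℝ) (A : Finset (Zd d)) : ℝ :=
  ∑ x ∈ A, equilRho P ρ (↑A) x

/-- Green's function `g(x,y) = Σ_t P^x[X_t = y]`. -/
def green {d : ℕ} (P : Zd d → Measure (ℕ → Zd d)) (x y : Zd d) : ℝ :=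
  ∑' t : ℕ, (P x {ω | ω t = y}).toReal

/-- `φ^{(ρ)}(A,B) = Σ_{x∈A} Σ_{y∈B} e_A^{(ρ)}(x) e_B^{(ρ)}(y) g(x,y)`. -/
def phiRho {d : ℕ} (P : Zd d → Measure (ℕ → Zd d)) (ρ : ℕ → ℝ) (A B : Finset (Zd d)) : ℝ :=
  ∑ x ∈ A, ∑ y ∈ B, equilRho P ρ (↑A) x * equilRho P ρ (↑B) y * green P x y

/-- `κ^{(ρ)}(A) = Σ_{x∈A} Σ_m (μ₁^{(m)}(ρ)/μ₂(ρ))·P^x[H̃_A > m]` (real-valued,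
for finite `A`). -/
def kappa {d : ℕ} (P : Zd d → Measure (ℕ → Zd d)) (ρ : ℕ → ℝ) (A : Finset (Zd d)) : ℝ :=
  ∑ x ∈ A, ∑' m : ℕ, (muTail 1 m ρ / mu 2 ρ) * (P x (NoReturnUpTo (↑A) (m : ℝ))).toReal

/-- `κ^{(ρ)}(A)` as an extended-real valued quantity, for arbitrary `A`. -/
def kappaE {d : ℕ} (P : Zd d → Measure (ℕ → Zd d)) (ρ : ℕ → ℝ) (A : Set (Zd d)) : ℝ≥0∞ :=
  ∑' x : Zd d,
    A.indicator (fun x => ∑' m : ℕ,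
      ENNReal.ofReal (muTail 1 m ρ / mu 2 ρ) * P x (NoReturnUpTo A (m : ℝ))) x

/-! ### Exploration processes -/

/-- First components: the `k`-th layer `L_k` of vertices; second components:
`∪_{i<k} L_i`.  Layer `L_{k+1}` is spanned by the trajectories of `ω` meeting `L_k`
but not `∪_{i<k} L_i`. -/
def exploreSets {d : ℕ} (ω : Config d) : ℕ → Set (Zd d) × Set (Zd d)
  | 0 => ({0}, ∅)
  | k + 1 =>
    ({y | ∃ η : Traj d, 0 < ω η ∧ hits η (exploreSets ω k).1 ∧
        ¬ hits η (exploreSets ω k).2 ∧ y ∈ η},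
      (exploreSets ω k).1 ∪ (exploreSets ω k).2)

/-- The `i`-th layer `𝓛_i` of trajectories of the exploration of the cluster of the
origin, as a sub-configuration of `ω`. -/
def exploreLayer {d : ℕ} (ω : Config d) : ℕ → Config d
  | 0 => fun _ => 0
  | k + 1 => fun η =>
      if hits η (exploreSets ω k).1 ∧ ¬ hits η (exploreSets ω k).2 then ω η else 0

/-- The vertex sets `L'_k` of the dominating exploration driven by the i.i.d.
sequence `j`. -/
def exploreSets' {d : ℕ} (j : ℕ → Config d) : ℕ → Set (Zd d)
  | 0 => {0}
  | k + 1 => {y | ∃ η : Traj d, 0 < j (k + 1) η ∧ hits η (exploreSets' j k) ∧ y ∈ η}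

/-- The trajectory layers `𝓛'_i` of the dominating exploration. -/
def exploreLayer' {d : ℕ} (j : ℕ → Config d) : ℕ → Config d
  | 0 => fun _ => 0
  | k + 1 => fun η => if hits η (exploreSets' j k) then j (k + 1) η else 0

/-- `W_k = 𝔼[κ^{(ρ)}(L'_k)]`. -/
def Wexp {d : ℕ} (P : Zd d → Measure (ℕ → Zd d)) (ρ : ℕ → ℝ)
    (J : Measure (ℕ → Config d)) (k : ℕ) : ℝ≥0∞ :=
  ∫⁻ j, kappaE P ρ (exploreSets' j k) ∂ J

/-- `V_k = 𝔼[|L'_k|]`, multiplied by `(log μ₁(ρ))⁻¹` when `d = 4`. -/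
def Vexp (d : ℕ) (ρ : ℕ → ℝ) (J : Measure (ℕ → Config d)) (k : ℕ) : ℝ≥0∞ :=
  (if d = 4 then ENNReal.ofReal (1 / Real.log (mu 1 ρ)) else 1) *
    ∫⁻ j, ENat.toENNReal (exploreSets' j k).encard ∂ J

/-! ### Two-sided finite random walk trajectories -/

/-- `μ(x,m,l)({η})`: the two-sided path `(X_{-m},…,X_l)` of a doubly infinite walk
with `X_0 = x` equals the list `η` (of length `m+l+1`, with `η[m] = x`)
with probability `(2d)^{-(m+l)}` for every admissible nearest-neighbour list. -/
def twoSidedProb (d : ℕ) (x : Zd d) (m l : ℕ) (η : Traj d) : ℝ :=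
  if η.length = m + l + 1 ∧ η.Chain' IsNN ∧ η[m]? = some x then
    (1 / (2 * (d : ℝ))) ^ (m + l) else 0

/-- The `ℓ^∞`-diameter of the range of `η` is at most `R`. -/
def DiamLE {d : ℕ} (η : Traj d) (R : ℝ) : Prop :=
  ∀ a ∈ η, ∀ b ∈ η, ∀ i, |((a i - b i : ℤ) : ℝ)| ≤ R

/-- `P^x[X[-m,-1] ∩ A = ∅]`: the probability that an `m`-step walk from `x`
avoids `A` at all positive times, written combinatorially. -/
def backAvoidProb (d : ℕ) (A : Set (Zd d)) (x : Zd d) (m : ℕ) : ℝ :=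
  ∑' w : Traj d,
    if w.length = m + 1 ∧ w.Chain' IsNN ∧ w[0]? = some x ∧
        (∀ i : ℕ, 0 < i → ∀ y, w[i]? = some y → y ∉ A) then
      (1 / (2 * (d : ℝ))) ^ m else 0

/-- `μ(x,m,l;A)({η}) = P^x[X[-m,l] = η | X[-m,-1] ∩ A = ∅]`. -/
def condTwoSidedProb (d : ℕ) (A : Set (Zd d)) (x : Zd d) (m l : ℕ) (η : Traj d) : ℝ :=
  (if ∀ i < m, ∀ y, η[i]? = some y → y ∉ A then twoSidedProb d x m l η else 0) /
    backAvoidProb d A x m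

/-- `π_A({η}) = Σ_{x∈A} Σ_{m,l} (ρ(m+l)/(μ₁(ρ)+1))·P^x[H̃_A > m]·μ(x,m,l;A)({η})`. -/
def piA (d : ℕ) (P : Zd d → Measure (ℕ → Zd d)) (ρ : ℕ → ℝ) (A : Finset (Zd d))
    (η : Traj d) : ℝ :=
  ∑ x ∈ A, ∑' m : ℕ, ∑' l : ℕ,
    ρ (m + l) / (mu 1 ρ + 1) * (P x (NoReturnUpTo (↑A) (m : ℝ))).toReal *
      condTwoSidedProb d (↑A) x m l η

/-- The sub-configuration of trajectories meeting `A`, i.e. `𝒳[A]`. -/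
def restrictConfig {d : ℕ} (A : Finset (Zd d)) (ω : Config d) : Config d :=
  fun η => if hits η (↑A) then ω η else 0

/-! ### Products and geometric laws -/

/-- The geometric measure `Geo(1/(T+1))` on `ℕ`. -/
def geoMeasure (T : ℕ) : Measure ℕ :=
  Measure.sum fun k : ℕ => (ENNReal.ofReal (geo (1 / ((T : ℝ) + 1)) k)) • Measure.dirac k

/-- `Q` is the product (independent coupling) of `μ` and `ν`. -/
def IsProdOf {α β : Type*} [MeasurableSpace α] [MeasurableSpace β]
    (Q : Measure (α × β)) (μ : Measure α) (ν : Measure β) : Prop :=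
  IsProbabilityMeasure Q ∧
    ∀ (A : Set α) (B : Set β), MeasurableSet A → MeasurableSet B → Q (A ×ˢ B) = μ A * ν B

/-! ### Coarse graining quantities -/

/-- The constant `c = 0.01`. -/
def cConst : ℝ := 0.01

/-- `R_n = ⌊√(μ₁(ρ_n))⌋`. -/
def Rn (ρ : ℕ → ℕ → ℝ) (n : ℕ) : ℕ := ⌊Real.sqrt (mu 1 (ρ n))⌋₊

/-- The mesoscopic scale `L_n`. -/
def Ln (d : ℕ) (ρ : ℕ → ℕ → ℝ) (n : ℕ) : ℝ :=
  if d = 4 then (Rn ρ n : ℝ) * (Real.log (Rn ρ n)) ^ (-cConst)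
  else (Rn ρ n : ℝ) ^ ((2 + cConst) / ((d : ℝ) - 2))

/-- The slowly growing factor `I_n`. -/
def In (d : ℕ) (ρ : ℕ → ℕ → ℝ) (n : ℕ) : ℝ :=
  if d = 4 then (Real.log (Rn ρ n)) ^ cConst else (Rn ρ n : ℝ) ^ cConst

/-- The scale `T'_n`. -/
def Tn' (d : ℕ) (ρ : ℕ → ℕ → ℝ) (n : ℕ) : ℕ :=
  if d = 4 then ⌊(Rn ρ n : ℝ) ^ (2 : ℕ) / Real.log (mu 1 (ρ n))⌋₊
  else ⌊(Rn ρ n : ℝ) ^ ((2 : ℝ) - cConst / 4)⌋₊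

/-- The scale `l_n`. -/
def lnPar (d : ℕ) (ρ : ℕ → ℕ → ℝ) (n : ℕ) : ℕ :=
  if d = 4 then ⌊(Rn ρ n : ℝ) * (Real.log (Rn ρ n)) ^ (-(2 * cConst))⌋₊
  else ⌊(Rn ρ n : ℝ) ^ ((1 : ℝ) - cConst / 4)⌋₊

/-- The scale `t_n`. -/
def tnPar (d : ℕ) (ρ : ℕ → ℕ → ℝ) (n : ℕ) : ℕ :=
  if d = 4 then ⌊(Rn ρ n : ℝ) ^ (2 : ℕ) / (Real.log (Rn ρ n)) ^ (10 : ℕ)⌋₊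
  else ⌊(Rn ρ n : ℝ) ^ ((2 : ℝ) - cConst)⌋₊

/-- `y` is within `ℓ^∞`-distance `r` of `z`. -/
def InBall {d : ℕ} (y z : Zd d) (r : ℝ) : Prop := ∀ i, |((y i - z i : ℤ) : ℝ)| ≤ r

/-- The `ℓ^∞` `r`-neighbourhood `B(A,r)`. -/
def nbhd {d : ℕ} (A : Set (Zd d)) (r : ℝ) : Set (Zd d) := {y | ∃ z ∈ A, InBall y z r}

/-- The sub-path `η[a, b]` of a trajectory. -/
def segment {d : ℕ} (η : Traj d) (a b : ℕ) : Traj d := (η.drop a).take (b - a + 1)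

/-- `η` is a typical trajectory (the event `𝒯_n = ℰ₁ ∩ ℰ₂ ∩ ℰ₃ ∩ ℰ₄`). -/
def Typical (d : ℕ) (P : Zd d → Measure (ℕ → Zd d)) (εd : ℝ) (ρ : ℕ → ℕ → ℝ)
    (kk KK M θ1 : ℝ) (n : ℕ) (η : Traj d) : Prop :=
  ValidTraj η ∧
  -- ℰ₁
  (kk * (Rn ρ n : ℝ) ^ 2 ≤ (len η : ℝ) ∧ (len η : ℝ) ≤ KK * (Rn ρ n : ℝ) ^ 2 ∧
    ∀ y ∈ η, InBall y η.headI (M * (Rn ρ n : ℝ))) ∧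
  -- ℰ₂
  (if d = 4 then
    (1 - θ1 ^ 2) * (Real.pi ^ 2 / 8) * (len η : ℝ) / Real.log (mu 1 (ρ n)) <
        capacity P η.toFinset ∧
      capTrunc P η.toFinset ((Rn ρ n : ℝ) ^ 2) <
        (1 + θ1 ^ 2) * (Real.pi ^ 2 / 8) * (len η : ℝ) / Real.log (mu 1 (ρ n))
  else
    (1 - θ1 ^ 2) * εd * (len η : ℝ) < capacity P η.toFinset ∧
      capacity P η.toFinset < (1 + θ1 ^ 2) * εd * (len η : ℝ)) ∧
  -- ℰ₃
  ((Set.ncard (nbhd (rangeSet η) (Ln d ρ n)) : ℝ) <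
    (Rn ρ n : ℝ) ^ 2 * (Ln d ρ n) ^ (d - 2) * (In d ρ n) ^ ((1 : ℝ) / 3)) ∧
  -- ℰ₄
  (∀ j : ℕ, j * Tn' d ρ n ≤ len η →
    if d = 4 then
      capacity P (segment η (j * Tn' d ρ n) (min ((j + 1) * Tn' d ρ n) (len η))).toFinset ≤
          (1 + θ1 ^ 2) * (Real.pi ^ 2 / 8) * (Tn' d ρ n : ℝ) / Real.log (mu 1 (ρ n)) ∧
        ∀ a ∈ segment η (j * Tn' d ρ n) (min ((j + 1) * Tn' d ρ n) (len η)),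
          ∀ b ∈ segment η (j * Tn' d ρ n) (min ((j + 1) * Tn' d ρ n) (len η)),
            ∀ i, |((a i - b i : ℤ) : ℝ)| <
              (1 / 2) * Real.sqrt (len η : ℝ) * (Real.log (mu 1 (ρ n))) ^ (-cConst)
    else
      capacity P (segment η (j * Tn' d ρ n) (min ((j + 1) * Tn' d ρ n) (len η))).toFinset ≤
        (1 + θ1 ^ 2) * εd * (Tn' d ρ n : ℝ))

/-- `x` belongs to the `*`-proper part `η̂` of the trajectory `η`. -/
def ProperStar (d : ℕ) (P : Zd d → Measure (ℕ → Zd d)) (ρ : ℕ → ℕ → ℝ)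
    (θ1 θ2 : ℝ) (n : ℕ) (η : Traj d) (x : Zd d) : Prop :=
  x ∈ rangeSet η ∧
    (if d = 4 then
      θ2 / Real.log (mu 1 (ρ n)) ≤ equil P (rangeSet η) x ∧
        (P x (NoReturnUpTo (rangeSet η)
            ((Rn ρ n : ℝ) ^ 2 / (Real.log (Rn ρ n)) ^ (10 : ℕ)))).toReal ≤
          (1 + θ1) * equil P (rangeSet η) x
    else θ2 ≤ equil P (rangeSet η) x)

/-! ### Finite expectation operator -/

/-- The eight steps. -/
abbrev Step := Fin 4 × Bool

/-- The lattice vector of a step. -/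
def vec (s : Step) : Zd 4 := Pi.single s.1 (if s.2 then 1 else -1)

/-- Opposite step. -/
def sneg (s : Step) : Step := (s.1, !s.2)

/-- Indicator of a proposition. -/
def ind (p : Prop) : ℝ := if p then 1 else 0

lemma ind_nonneg (p : Prop) : 0 ≤ ind p := by unfold ind; split_ifs <;> norm_num
lemma ind_le_one (p : Prop) : ind p ≤ 1 := by unfold ind; split_ifs <;> norm_num
lemma ind_true {p : Prop} (h : p) : ind p = 1 := by simp [ind, h]
lemma ind_false {p : Prop} (h : ¬ p) : ind p = 0 := by simp [ind, h]
lemma ind_mono {p q : Prop} (h : p → q) : ind p ≤ ind q := by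
  by_cases hp : p
  · rw [ind_true hp, ind_true (h hp)]
  · rw [ind_false hp]; exact ind_nonneg q
lemma ind_congr {p q : Prop} (h : p ↔ q) : ind p = ind q :=
  le_antisymm (ind_mono h.1) (ind_mono h.2)
lemma ind_or_le {p q r : Prop} (h : p → q ∨ r) : ind p ≤ ind q + ind r := by
  by_cases hp : p
  · rcases h hp with hq | hr
    · rw [ind_true hp, ind_true hq]; linarith [ind_nonneg r]
    · rw [ind_true hp, ind_true hr]; linarith [ind_nonneg q]
  · rw [ind_false hp]; linarith [ind_nonneg q, ind_nonneg r]
lemma ind_and (p q : Prop) : ind (p ∧ q) = ind p * ind q := by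
  by_cases hp : p <;> by_cases hq : q <;> simp [ind, hp, hq]
lemma ind_exists_le {ι : Type*} (s : Finset ι) (p : ι → Prop) :
    ind (∃ i ∈ s, p i) ≤ ∑ i ∈ s, ind (p i) := by
  by_cases h : ∃ i ∈ s, p i
  · obtain ⟨i, hi, hp⟩ := h
    calc ind (∃ i ∈ s, p i) ≤ 1 := ind_le_one _
      _ = ind (p i) := (ind_true hp).symm
      _ ≤ _ := Finset.single_le_sum (f := fun i => ind (p i)) (fun j _ => ind_nonneg _) hi
  · rw [ind_false h]; exact Finset.sum_nonneg fun j _ => ind_nonneg _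

/-- Expectation over `n` independent uniform steps. -/
def EE : ℕ → (List Step → ℝ) → ℝ
  | 0, F => F []
  | n + 1, F => (1 / 8) * ∑ s : Step, EE n (fun l => F (s :: l))

lemma EE_zero (F : List Step → ℝ) : EE 0 F = F [] := rfl
lemma EE_succ (n : ℕ) (F : List Step → ℝ) :
    EE (n + 1) F = (1 / 8) * ∑ s : Step, EE n (fun l => F (s :: l)) := rfl

lemma EE_mono {n : ℕ} {F G : List Step → ℝ} (h : ∀ l, l.length = n → F l ≤ G l) :
    EE n F ≤ EE n G := by
  induction n generalizing F G with
  | zero => exact h [] rfl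
  | succ n ih =>
    rw [EE_succ, EE_succ]
    gcongr with s
    exact ih fun l hl => h _ (by simp [hl])

lemma EE_congr {n : ℕ} {F G : List Step → ℝ} (h : ∀ l, l.length = n → F l = G l) :
    EE n F = EE n G :=
  le_antisymm (EE_mono fun l hl => (h l hl).le) (EE_mono fun l hl => (h l hl).ge)

lemma EE_const (n : ℕ) (c : ℝ) : EE n (fun _ => c) = c := by
  induction n with
  | zero => rfl
  | succ n ih => rw [EE_succ]; simp [ih]

lemma EE_nonneg {n : ℕ} {F : List Step → ℝ} (h : ∀ l, l.length = n → 0 ≤ F l) : 0 ≤ EE n F := by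
  rw [← EE_const n 0]; exact EE_mono h

lemma EE_le_one {n : ℕ} {F : List Step → ℝ} (h : ∀ l, l.length = n → F l ≤ 1) : EE n F ≤ 1 := by
  rw [← EE_const n 1]; exact EE_mono h

lemma EE_add (n : ℕ) (F G : List Step → ℝ) :
    EE n (fun l => F l + G l) = EE n F + EE n G := by
  induction n generalizing F G with
  | zero => rfl
  | succ n ih => simp only [EE_succ, ih, Finset.sum_add_distrib, mul_add]

lemma EE_mul_left (n : ℕ) (c : ℝ) (F : List Step → ℝ) :
    EE n (fun l => c * F l) = c * EE n F := by
  induction n generalizing F with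
  | zero => rfl
  | succ n ih => simp only [EE_succ, ih, ← Finset.mul_sum]; ring

lemma EE_mul_right (n : ℕ) (c : ℝ) (F : List Step → ℝ) :
    EE n (fun l => F l * c) = EE n F * c := by
  simp only [mul_comm _ c, EE_mul_left]

lemma EE_sub (n : ℕ) (F G : List Step → ℝ) :
    EE n (fun l => F l - G l) = EE n F - EE n G := by
  have h := EE_add n F (fun l => (-1) * G l)
  rw [EE_mul_left] at h
  simp only [sub_eq_add_neg]
  simpa using h

lemma EE_sum {ι : Type*} (n : ℕ) (s : Finset ι) (F : ι → List Step → ℝ) :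
    EE n (fun l => ∑ i ∈ s, F i l) = ∑ i ∈ s, EE n (F i) := by
  induction s using Finset.induction_on with
  | empty => simp [EE_const]
  | insert a s ha ih =>
    simp only [Finset.sum_insert ha]
    rw [EE_add n (F a), ih]

lemma EE_append (m n : ℕ) (F : List Step → ℝ) :
    EE (m + n) F = EE m (fun u => EE n (fun v => F (u ++ v))) := by
  induction m generalizing F with
  | zero => simp [EE_zero]
  | succ m ih =>
    rw [show m + 1 + n = (m + n) + 1 by omega, EE_succ, EE_succ]
    congr 1
    refine Finset.sum_congr rfl fun s _ => ?_
    rw [ih]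
    rfl

lemma EE_comm (m n : ℕ) (F : List Step → List Step → ℝ) :
    EE m (fun u => EE n (fun v => F u v)) = EE n (fun v => EE m (fun u => F u v)) := by
  induction m generalizing F with
  | zero => rfl
  | succ m ih =>
    simp only [EE_succ, ih]
    rw [EE_mul_left, EE_sum]

lemma EE_one (F : List Step → ℝ) : EE 1 F = (1 / 8) * ∑ s : Step, F [s] := rfl

lemma EE_reverse (n : ℕ) (F : List Step → ℝ) : EE n (fun l => F l.reverse) = EE n F := by
  induction n generalizing F with
  | zero => rfl
  | succ n ih =>
    rw [EE_append n 1 F, EE_succ]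
    simp only [List.reverse_cons, EE_one]
    rw [EE_mul_left, EE_sum]
    congr 1
    refine Finset.sum_congr rfl fun s _ => ?_
    exact ih (fun l => F (l ++ [s]))

lemma sneg_sneg (s : Step) : sneg (sneg s) = s := by simp [sneg]

lemma vec_sneg (s : Step) : vec (sneg s) = - vec s := by
  rcases s with ⟨i, b⟩
  cases b <;> simp [vec, sneg, ← Pi.single_neg]

lemma EE_map_sneg (n : ℕ) (F : List Step → ℝ) : EE n (fun l => F (l.map sneg)) = EE n F := by
  induction n generalizing F with
  | zero => rfl
  | succ n ih =>
    rw [EE_succ, EE_succ]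
    congr 1
    simp only [List.map_cons]
    refine Finset.sum_bij' (fun s _ => sneg s) (fun s _ => sneg s) ?_ ?_ ?_ ?_ ?_
    · simp
    · simp
    · intro s _; exact sneg_sneg s
    · intro s _; exact sneg_sneg s
    · intro s _; exact ih (fun l => F (sneg s :: l))

/-- Time reversal of a list of steps. -/
def rv (l : List Step) : List Step := (l.map sneg).reverse

lemma length_rv (l : List Step) : (rv l).length = l.length := by simp [rv]

lemma rv_rv (l : List Step) : rv (rv l) = l := by
  simp [rv, List.map_reverse, Function.comp_def, sneg_sneg]

lemma EE_rv (n : ℕ) (F : List Step → ℝ) : EE n (fun l => F (rv l)) = EE n F := by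
  unfold rv
  rw [EE_map_sneg n (fun l => F l.reverse), EE_reverse]

/-- Endpoint. -/
def tot (l : List Step) : Zd 4 := (l.map vec).sum

/-- Position at time `k`. -/
def pos (l : List Step) (k : ℕ) : Zd 4 := tot (l.take k)

@[simp] lemma tot_nil : tot [] = 0 := rfl
@[simp] lemma tot_cons (s : Step) (l : List Step) : tot (s :: l) = vec s + tot l := by simp [tot]
@[simp] lemma tot_append (u v : List Step) : tot (u ++ v) = tot u + tot v := by simp [tot]
lemma tot_map_sneg (l : List Step) : tot (l.map sneg) = - tot l := by
  induction l with
  | nil => simp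
  | cons s l ih => simp only [List.map_cons, tot_cons, ih, vec_sneg]; abel
lemma tot_reverse (l : List Step) : tot l.reverse = tot l := by
  induction l with
  | nil => simp
  | cons s l ih => simp [ih, add_comm]
lemma tot_rv (l : List Step) : tot (rv l) = - tot l := by
  rw [rv, tot_reverse, tot_map_sneg]

@[simp] lemma pos_zero (l : List Step) : pos l 0 = 0 := by simp [pos]
lemma pos_length {l : List Step} {n : ℕ} (h : l.length ≤ n) : pos l n = tot l := by
  simp [pos, List.take_of_length_le h]
lemma pos_append_left {u v : List Step} {k : ℕ} (h : k ≤ u.length) :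
    pos (u ++ v) k = pos u k := by
  simp [pos, List.take_append_of_le_length h]
lemma pos_append_right (u v : List Step) (k : ℕ) :
    pos (u ++ v) (u.length + k) = tot u + pos v k := by
  simp [pos, List.take_append, List.take_of_length_le (Nat.le_add_right u.length k)]
lemma pos_append_right' {u v : List Step} {m : ℕ} (hm : u.length = m) (k : ℕ) :
    pos (u ++ v) (m + k) = tot u + pos v k := by
  subst hm; exact pos_append_right u v k
lemma pos_take {l : List Step} {k m : ℕ} (h : k ≤ m) : pos (l.take m) k = pos l k := by
  simp [pos, List.take_take, h]
lemma pos_rv (l : List Step) (k : ℕ) :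
    pos (rv l) k = pos l (l.length - k) - tot l := by
  have e : (rv l).take k = rv (l.drop (l.length - k)) := by
    simp [rv, List.take_reverse]
  have e2 : tot l = pos l (l.length - k) + tot (l.drop (l.length - k)) := by
    rw [pos, ← tot_append, List.take_append_drop]
  rw [pos, e, tot_rv, e2]; abel

lemma EE_take {k n : ℕ} (h : k ≤ n) (F : List Step → ℝ) :
    EE n (fun l => F (l.take k)) = EE k F := by
  obtain ⟨m, rfl⟩ := Nat.exists_eq_add_of_le h
  rw [EE_append]
  refine EE_congr fun u hu => ?_
  rw [show (fun v => F ((u ++ v).take k)) = fun _ => F u by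
    funext v; rw [List.take_append_of_le_length hu.ge, List.take_of_length_le hu.le], EE_const]

/-- Splitting at time `k` followed by extension to a longer time horizon. -/
lemma EE_split {k m n : ℕ} (h : k + m ≤ n) (F : List Step → ℝ) :
    EE k (fun u => EE m (fun v => F (u ++ v))) = EE n (fun l => F (l.take (k + m))) := by
  rw [EE_take h, EE_append]

/-! ### Heat kernel -/

/-- Transition probabilities. -/
def hk (n : ℕ) (x : Zd 4) : ℝ := EE n (fun l => ind (tot l = x))

lemma hk_nonneg (n : ℕ) (x : Zd 4) : 0 ≤ hk n x := EE_nonneg fun _ _ => ind_nonneg _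

lemma hk_neg (n : ℕ) (x : Zd 4) : hk n (-x) = hk n x := by
  unfold hk
  rw [← EE_map_sneg n]
  refine EE_congr fun l _ => ind_congr ?_
  rw [tot_map_sneg, neg_inj]

lemma hk_zero (x : Zd 4) : hk 0 x = ind (x = 0) := by
  rw [hk, EE_zero]; exact ind_congr (by rw [tot_nil, eq_comm])

lemma hk_succ (n : ℕ) (x : Zd 4) : hk (n + 1) x = (1 / 8) * ∑ s : Step, hk n (x - vec s) := by
  unfold hk
  rw [EE_succ]
  congr 1
  refine Finset.sum_congr rfl fun s _ => EE_congr fun l _ => ind_congr ?_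
  rw [tot_cons, eq_sub_iff_add_eq, add_comm]

lemma hk_ck (i s : ℕ) : EE i (fun u => hk s (tot u)) = hk (i + s) 0 := by
  rw [hk, EE_append]
  refine EE_congr fun u _ => ?_
  rw [hk, ← EE_map_sneg]
  refine EE_congr fun v _ => ind_congr ?_
  rw [tot_map_sneg, tot_append, neg_eq_iff_add_eq_zero, add_comm]

/-- Normalised Lebesgue measure on the circle. -/
def circ : Measure ℝ := (ENNReal.ofReal (1 / (2 * Real.pi))) • volume.restrict (Set.Ioc (-Real.pi) Real.pi)

/-- Normalised Lebesgue measure on the torus. -/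
def torus : Measure (Fin 4 → ℝ) := Measure.pi (fun _ => circ)

instance : IsProbabilityMeasure circ := by
  constructor
  rw [circ, Measure.smul_apply, Measure.restrict_apply MeasurableSet.univ, Set.univ_inter,
    Real.volume_Ioc, smul_eq_mul, ← ENNReal.ofReal_mul (by positivity)]
  rw [show 1 / (2 * Real.pi) * (Real.pi - -Real.pi) = 1 by field_simp; ring]
  simp

instance : IsProbabilityMeasure torus := by unfold torus; infer_instance

lemma integral_circ {E : Type*} [NormedAddCommGroup E] [NormedSpace ℝ E] (f : ℝ → E) :
    ∫ θ, f θ ∂circ = (1 / (2 * Real.pi)) • ∫ θ in (-Real.pi)..Real.pi, f θ := by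
  rw [circ, integral_smul_measure, intervalIntegral.integral_of_le (by linarith [Real.pi_pos]),
    ENNReal.toReal_ofReal (by positivity)]

/-- The characteristic function of a step. -/
def chf (θ : Fin 4 → ℝ) : ℝ := (1 / 4) * ∑ i, Real.cos (θ i)

/-- Pairing. -/
def pair (x : Zd 4) (θ : Fin 4 → ℝ) : ℝ := ∑ i, (x i : ℝ) * θ i

lemma continuous_chf : Continuous chf := by unfold chf; fun_prop
lemma continuous_pair (x : Zd 4) : Continuous (pair x) := by unfold pair; fun_prop

lemma abs_chf_le (θ : Fin 4 → ℝ) : |chf θ| ≤ 1 := by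
  unfold chf
  rw [Fin.sum_univ_four, abs_le]
  constructor
  · linarith [Real.neg_one_le_cos (θ 0), Real.neg_one_le_cos (θ 1), Real.neg_one_le_cos (θ 2), Real.neg_one_le_cos (θ 3)]
  · linarith [Real.cos_le_one (θ 0), Real.cos_le_one (θ 1), Real.cos_le_one (θ 2), Real.cos_le_one (θ 3)]

lemma integrable_torus {f : (Fin 4 → ℝ) → ℝ} (hf : Continuous f) {C : ℝ} (h : ∀ θ, |f θ| ≤ C) :
    Integrable f torus :=
  Integrable.of_bound hf.aestronglyMeasurable C (Eventually.of_forall h)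

lemma integrable_basic (n : ℕ) (x : Zd 4) :
    Integrable (fun θ => chf θ ^ n * Real.cos (pair x θ)) torus := by
  refine integrable_torus ((continuous_chf.pow n).mul (Real.continuous_cos.comp (continuous_pair x)))
    (C := 1) fun θ => ?_
  rw [abs_mul, abs_pow]
  exact mul_le_one₀ (pow_le_one₀ (abs_nonneg _) (abs_chf_le θ)) (abs_nonneg _) (Real.abs_cos_le_one _)

lemma integral_exp_circ (k : ℤ) :
    ∫ θ, Complex.exp (k * θ * Complex.I) ∂circ = if k = 0 then 1 else 0 := by
  rw [integral_circ]
  split_ifs with h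
  · subst h
    simp
    have : (Real.pi : ℂ) ≠ 0 := by exact_mod_cast Real.pi_ne_zero
    field_simp
    norm_num
  · have hk : ((k : ℂ) * Complex.I) ≠ 0 := by simp [h]
    have := integral_exp_mul_complex (a := -Real.pi) (b := Real.pi) hk
    rw [show (fun θ : ℝ => Complex.exp (k * θ * Complex.I)) =
      fun θ : ℝ => Complex.exp (k * Complex.I * θ) by funext θ; congr 1; ring, this]
    have e : Complex.exp (k * Complex.I * (Real.pi : ℝ)) =
        Complex.exp (k * Complex.I * ((-Real.pi : ℝ) : ℂ)) := by
      rw [Complex.exp_eq_exp_iff_exists_int]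
      exact ⟨k, by push_cast; ring⟩
    rw [e]; simp

lemma integral_cos_pair (x : Zd 4) : ∫ θ, Real.cos (pair x θ) ∂torus = ind (x = 0) := by
  have h1 : ∫ θ : Fin 4 → ℝ, ∏ i, Complex.exp (x i * θ i * Complex.I) ∂torus =
      ∏ i, ∫ θ, Complex.exp (x i * θ * Complex.I) ∂circ := by
    exact integral_fintype_prod_eq_prod (f := fun i (θ : ℝ) => Complex.exp (x i * θ * Complex.I))
      (μ := fun _ : Fin 4 => circ)
  have h2 : ∀ θ : Fin 4 → ℝ, Real.cos (pair x θ) =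
      RCLike.re (∏ i, Complex.exp (x i * θ i * Complex.I)) := by
    intro θ
    rw [← Complex.exp_sum, ← Finset.sum_mul]
    have : (∑ i, (x i : ℂ) * (θ i : ℂ)) = ((pair x θ : ℝ) : ℂ) := by simp [pair]
    rw [this]
    exact (Complex.exp_ofReal_mul_I_re _).symm
  simp only [h2]
  rw [integral_re, h1]
  · simp only [integral_exp_circ]
    by_cases hx : x = 0
    · subst hx; simp [ind]
    · rw [ind_false hx]
      obtain ⟨i, hi⟩ : ∃ i, x i ≠ 0 := by
        by_contra hcon; push Not at hcon; exact hx (funext hcon)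
      rw [Finset.prod_eq_zero (Finset.mem_univ i) (by simp [hi])]
      simp
  · refine Integrable.of_bound (C := 1) ?_ ?_
    · apply Continuous.aestronglyMeasurable; fun_prop
    · refine Eventually.of_forall fun θ => ?_
      rw [norm_prod]
      refine le_of_eq (Finset.prod_eq_one fun i _ => ?_)
      rw [show (x i : ℂ) * (θ i : ℂ) * Complex.I = (((x i : ℝ) * θ i : ℝ) : ℂ) * Complex.I by push_cast; ring]
      exact Complex.norm_exp_ofReal_mul_I _

lemma pair_sub_vec (x : Zd 4) (s : Step) (θ : Fin 4 → ℝ) :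
    pair (x - vec s) θ = pair x θ - (if s.2 then θ s.1 else - θ s.1) := by
  unfold pair
  simp only [Pi.sub_apply, Int.cast_sub, sub_mul, Finset.sum_sub_distrib]
  congr 1
  rw [Finset.sum_eq_single s.1]
  · simp only [vec, Pi.single_eq_same]; split_ifs <;> simp
  · intro b _ hb; simp [vec, Pi.single_eq_of_ne hb]
  · simp

lemma hk_fourier (n : ℕ) (x : Zd 4) :
    hk n x = ∫ θ, chf θ ^ n * Real.cos (pair x θ) ∂torus := by
  induction n generalizing x with
  | zero => simp only [pow_zero, one_mul]; rw [integral_cos_pair, hk_zero]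
  | succ n ih =>
    rw [hk_succ]
    simp only [ih]
    rw [← integral_finsetSum _ (fun s _ => integrable_basic n _), ← integral_const_mul]
    congr 1
    funext θ
    simp only [pair_sub_vec]
    rw [Fintype.sum_prod_type]
    simp only [Fintype.sum_bool, if_true, Bool.false_eq_true, if_false]
    have : ∀ i, chf θ ^ n * Real.cos (pair x θ - θ i) + chf θ ^ n * Real.cos (pair x θ - -θ i) =
        2 * chf θ ^ n * Real.cos (pair x θ) * Real.cos (θ i) := by
      intro i
      rw [sub_neg_eq_add, Real.cos_sub, Real.cos_add]; ring
    simp only [this]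
    rw [← Finset.mul_sum, pow_succ]
    unfold chf
    ring

lemma integral_circ_exp_le (m : ℕ) (hm : 0 < m) :
    ∫ θ, Real.exp (-((m : ℝ) / 4) * (1 - |Real.cos θ|)) ∂circ ≤ 10 / Real.sqrt m := by
  have hm' : (0 : ℝ) < m := by exact_mod_cast hm
  set f : ℝ → ℝ := fun θ => Real.exp (-((m : ℝ) / 4) * (1 - |Real.cos θ|)) with hf
  have hfc : Continuous f := by rw [hf]; fun_prop
  have hper : Function.Periodic f Real.pi := by
    intro θ; simp only [hf, Real.cos_add_pi, abs_neg]
  have hpi := Real.pi_pos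
  have h1 : ∫ θ in (-Real.pi)..Real.pi, f θ = 2 * ∫ θ in (-(Real.pi / 2))..(Real.pi / 2), f θ := by
    rw [← intervalIntegral.integral_add_adjacent_intervals (b := 0)
      (hfc.intervalIntegrable _ _) (hfc.intervalIntegrable _ _)]
    have a1 := hper.intervalIntegral_add_eq (-Real.pi) (-(Real.pi / 2))
    have a2 := hper.intervalIntegral_add_eq 0 (-(Real.pi / 2))
    rw [show -Real.pi + Real.pi = 0 by ring, show -(Real.pi / 2) + Real.pi = Real.pi / 2 by ring] at a1
    rw [show 0 + Real.pi = Real.pi by ring, show -(Real.pi / 2) + Real.pi = Real.pi / 2 by ring] at a2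
    rw [a1, a2]; ring
  set b : ℝ := m / (2 * Real.pi ^ 2) with hb
  have hb0 : 0 < b := by positivity
  have h2 : ∫ θ in (-(Real.pi / 2))..(Real.pi / 2), f θ ≤ Real.sqrt (Real.pi / b) := by
    rw [← integral_gaussian, intervalIntegral.integral_of_le (by linarith)]
    calc ∫ θ in Set.Ioc (-(Real.pi / 2)) (Real.pi / 2), f θ
        ≤ ∫ θ in Set.Ioc (-(Real.pi / 2)) (Real.pi / 2), Real.exp (-b * θ ^ 2) := by
          refine setIntegral_mono_on ?_ (integrable_exp_neg_mul_sq hb0).integrableOn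
            measurableSet_Ioc ?_
          · exact (hfc.integrableOn_Icc).mono_set Set.Ioc_subset_Icc_self
          · intro θ hθ
            apply Real.exp_le_exp.2
            have h3 : |θ| ≤ Real.pi / 2 := abs_le.2 ⟨hθ.1.le, hθ.2⟩
            have h4 := Real.mul_abs_le_abs_sin h3
            have h5 : (2 / Real.pi * |θ|) ^ 2 ≤ Real.sin θ ^ 2 := by
              rw [← sq_abs (Real.sin θ)]
              exact pow_le_pow_left₀ (by positivity) h4 2
            rw [mul_pow, sq_abs] at h5
            have h6 : Real.sin θ ^ 2 / 2 ≤ 1 - |Real.cos θ| := by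
              have := Real.sin_sq_add_cos_sq θ
              have h7 := sq_abs (Real.cos θ)
              nlinarith [sq_nonneg (1 - |Real.cos θ|), Real.abs_cos_le_one θ]
            have h8 : b * θ ^ 2 = (m / 4) * ((2 / Real.pi) ^ 2 * θ ^ 2 / 2) := by
              rw [hb]; field_simp; ring
            have h9 : (m / 4 : ℝ) * ((2 / Real.pi) ^ 2 * θ ^ 2 / 2) ≤ (m / 4) * (1 - |Real.cos θ|) := by
              gcongr; linarith
            linarith
      _ ≤ _ := setIntegral_le_integral (integrable_exp_neg_mul_sq hb0)
          (Eventually.of_forall fun θ => (Real.exp_pos _).le)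
  rw [integral_circ, h1, smul_eq_mul]
  have h3 : Real.sqrt (Real.pi / b) ≤ 10 * Real.pi / Real.sqrt m := by
    rw [Real.sqrt_le_left (by positivity), div_pow, Real.sq_sqrt hm'.le, hb, div_div_eq_mul_div]
    gcongr
    nlinarith [Real.pi_lt_four, pow_pos hpi 2]
  calc 1 / (2 * Real.pi) * (2 * ∫ θ in (-(Real.pi / 2))..(Real.pi / 2), f θ)
      ≤ 1 / (2 * Real.pi) * (2 * (10 * Real.pi / Real.sqrt m)) := by
        gcongr; exact h2.trans h3
    _ = 10 / Real.sqrt m := by field_simp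

lemma hk_upper (m : ℕ) (hm : 0 < m) : hk m 0 ≤ 10000 / (m : ℝ) ^ 2 := by
  have hm' : (0 : ℝ) < m := by exact_mod_cast hm
  have h1 : hk m 0 ≤ ∫ θ : Fin 4 → ℝ, ∏ i, Real.exp (-((m : ℝ) / 4) * (1 - |Real.cos (θ i)|)) ∂torus := by
    rw [hk_fourier]
    refine integral_mono (integrable_basic m 0) ?_ fun θ => ?_
    · refine integrable_torus (by fun_prop) (C := 1) fun θ => ?_
      rw [Finset.abs_prod]
      refine Finset.prod_le_one (fun i _ => abs_nonneg _) fun i _ => ?_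
      rw [Real.abs_exp, Real.exp_le_one_iff]
      nlinarith [Real.abs_cos_le_one (θ i)]
    · have e : pair 0 θ = 0 := by simp [pair]
      simp only [e, Real.cos_zero, mul_one]
      rw [← Real.exp_sum]
      have a1 : |chf θ| ≤ (1 / 4) * ∑ i, |Real.cos (θ i)| := by
        unfold chf
        rw [abs_mul, abs_of_pos (by norm_num : (0 : ℝ) < 1 / 4)]
        gcongr
        exact Finset.abs_sum_le_sum_abs _ _
      calc chf θ ^ m ≤ |chf θ| ^ m := by rw [← abs_pow]; exact le_abs_self _
        _ ≤ (Real.exp (|chf θ| - 1)) ^ m := by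
            gcongr
            linarith [Real.add_one_le_exp (|chf θ| - 1)]
        _ = Real.exp (m * (|chf θ| - 1)) := by rw [← Real.exp_nat_mul]
        _ ≤ _ := by
            apply Real.exp_le_exp.2
            rw [← Finset.mul_sum, Finset.sum_sub_distrib]
            simp
            nlinarith
  have h2 : ∫ θ : Fin 4 → ℝ, ∏ i, Real.exp (-((m : ℝ) / 4) * (1 - |Real.cos (θ i)|)) ∂torus =
      ∏ _i : Fin 4, ∫ θ, Real.exp (-((m : ℝ) / 4) * (1 - |Real.cos θ|)) ∂circ :=
    integral_fintype_prod_eq_prod (f := fun _ (θ : ℝ) => Real.exp (-((m : ℝ) / 4) * (1 - |Real.cos θ|)))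
      (μ := fun _ : Fin 4 => circ)
  rw [h2] at h1
  refine h1.trans ?_
  rw [Finset.prod_const, Finset.card_univ, Fintype.card_fin]
  calc (∫ θ, Real.exp (-((m : ℝ) / 4) * (1 - |Real.cos θ|)) ∂circ) ^ 4
      ≤ (10 / Real.sqrt m) ^ 4 := by
        apply pow_le_pow_left₀ _ (integral_circ_exp_le m hm)
        exact integral_nonneg fun θ => (Real.exp_pos _).le
    _ = 10000 / (m : ℝ) ^ 2 := by
        rw [div_pow, show Real.sqrt m ^ 4 = (Real.sqrt m ^ 2) ^ 2 by ring, Real.sq_sqrt hm'.le]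
        norm_num

lemma hk_lower (k : ℕ) (hk0 : 0 < k) : (1 / 4) * (1 / Real.pi ^ 4) / (k : ℝ) ^ 2 ≤ hk (2 * k) 0 := by
  have hk' : (0 : ℝ) < k := by exact_mod_cast hk0
  have hk1 : (1 : ℝ) ≤ k := by exact_mod_cast hk0
  have hpi := Real.pi_pos
  set δ : ℝ := 1 / Real.sqrt k with hδ
  have hδ0 : 0 < δ := by positivity
  have hδ2 : δ ^ 2 = 1 / k := by rw [hδ, div_pow, Real.sq_sqrt hk'.le, one_pow]
  have hδ1 : δ ≤ 1 := by
    rw [hδ, div_le_one (by positivity)]; exact Real.one_le_sqrt.2 hk1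
  set S : Set (Fin 4 → ℝ) := Set.univ.pi (fun _ => Set.Icc (-δ) δ) with hS
  have hSm : MeasurableSet S := MeasurableSet.univ_pi fun _ => measurableSet_Icc
  have hcirc : circ (Set.Icc (-δ) δ) = ENNReal.ofReal (δ / Real.pi) := by
    rw [circ, Measure.smul_apply, Measure.restrict_apply measurableSet_Icc,
      Set.inter_eq_left.2, Real.volume_Icc, smul_eq_mul, ← ENNReal.ofReal_mul (by positivity)]
    · congr 1; field_simp; ring
    · intro y hy
      have := Real.pi_gt_three
      exact ⟨by linarith [hy.1], by linarith [hy.2]⟩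
  have hSv : torus.real S = (δ / Real.pi) ^ 4 := by
    rw [Measure.real, torus, hS, Measure.pi_pi]
    simp only [hcirc]
    rw [Finset.prod_const, Finset.card_univ, Fintype.card_fin, ← ENNReal.ofReal_pow (by positivity),
      ENNReal.toReal_ofReal (by positivity)]
  have e : ∀ θ, pair 0 θ = 0 := fun θ => by simp [pair]
  have hinteg := integrable_basic (2 * k) 0
  rw [hk_fourier]
  simp only [e, Real.cos_zero, mul_one] at hinteg ⊢
  calc (1 / 4) * (1 / Real.pi ^ 4) / (k : ℝ) ^ 2 = 1 / 4 * torus.real S := by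
        rw [hSv, div_pow, show δ ^ 4 = (δ ^ 2) ^ 2 by ring, hδ2]; field_simp
    _ ≤ ∫ θ in S, chf θ ^ (2 * k) ∂torus := by
        refine setIntegral_ge_of_const_le_real hSm (measure_ne_top _ _) ?_ hinteg.integrableOn
        intro θ hθ
        have h1 : 1 - 1 / (2 * k) ≤ chf θ := by
          have h2 : ∀ i, 1 - 1 / (2 * (k : ℝ)) ≤ Real.cos (θ i) := by
            intro i
            have h3 := hθ i (Set.mem_univ i)
            have h4 : θ i ^ 2 ≤ δ ^ 2 := sq_le_sq' h3.1 h3.2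
            have h5 := Real.one_sub_sq_div_two_le_cos (x := θ i)
            have h6 : 1 / (2 * (k : ℝ)) = δ ^ 2 / 2 := by rw [hδ2]; field_simp
            linarith
          unfold chf
          rw [Fin.sum_univ_four]
          linarith [h2 0, h2 1, h2 2, h2 3]
        have h2 : (1 : ℝ) / (2 * k) ≤ 1 / 2 := by
          rw [div_le_div_iff₀ (by positivity) (by norm_num)]; linarith
        have h3 := one_add_mul_le_pow (a := -(1 / (2 * (k : ℝ)))) (by linarith) k
        have h4 : 1 + (k : ℝ) * -(1 / (2 * (k : ℝ))) = 1 / 2 := by field_simp; norm_num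
        rw [h4] at h3
        have h5 : 1 / 2 ≤ chf θ ^ k := h3.trans (pow_le_pow_left₀ (by linarith) (by linarith) k)
        rw [mul_comm, pow_mul]
        nlinarith
    _ ≤ ∫ θ, chf θ ^ (2 * k) ∂torus := by
        refine setIntegral_le_integral hinteg (Eventually.of_forall fun θ => ?_)
        simp only [Pi.zero_apply]
        rw [pow_mul]; positivity

/-- Squared Euclidean norm. -/
def nsq (x : Zd 4) : ℝ := ∑ i, (x i : ℝ) ^ 2

lemma nsq_nonneg (x : Zd 4) : 0 ≤ nsq x := Finset.sum_nonneg fun _ _ => sq_nonneg _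

lemma abs_sin_nat_mul (n : ℕ) (a : ℝ) : |Real.sin (n * a)| ≤ n * |Real.sin a| := by
  induction n with
  | zero => simp
  | succ n ih =>
    push_cast
    rw [add_mul, one_mul, Real.sin_add]
    calc |Real.sin (n * a) * Real.cos a + Real.cos (n * a) * Real.sin a|
        ≤ |Real.sin (n * a)| * |Real.cos a| + |Real.cos (n * a)| * |Real.sin a| := by
          rw [← abs_mul, ← abs_mul]; exact abs_add_le _ _
      _ ≤ |Real.sin (n * a)| * 1 + 1 * |Real.sin a| := by
          gcongr <;> exact Real.abs_cos_le_one _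
      _ ≤ _ := by linarith

lemma abs_sin_int_mul (n : ℤ) (a : ℝ) : |Real.sin (n * a)| ≤ |(n : ℝ)| * |Real.sin a| := by
  have h := abs_sin_nat_mul n.natAbs a
  rw [Nat.cast_natAbs, Int.cast_abs] at h
  rcases abs_choice (n : ℝ) with h' | h'
  · rw [h'] at h ⊢; exact h
  · rw [h'] at h ⊢; rwa [neg_mul, Real.sin_neg, abs_neg] at h

lemma abs_sin_add_le' (a b : ℝ) : |Real.sin (a + b)| ≤ |Real.sin a| + |Real.sin b| := by
  rw [Real.sin_add]
  calc |Real.sin a * Real.cos b + Real.cos a * Real.sin b|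
      ≤ |Real.sin a| * |Real.cos b| + |Real.cos a| * |Real.sin b| := by
        rw [← abs_mul, ← abs_mul]; exact abs_add_le _ _
    _ ≤ |Real.sin a| * 1 + 1 * |Real.sin b| := by
        gcongr <;> exact Real.abs_cos_le_one _
    _ = _ := by ring

lemma one_sub_cos_le (x : Zd 4) (θ : Fin 4 → ℝ) :
    1 - Real.cos (pair x θ) ≤ 4 * nsq x * (1 - chf θ) := by
  have hs : ∀ y : ℝ, 1 - Real.cos y = 2 * Real.sin (y / 2) ^ 2 := by
    intro y
    have := Real.cos_sq (y / 2)
    rw [show 2 * (y / 2) = y by ring] at this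
    have h2 := Real.sin_sq_add_cos_sq (y / 2)
    linarith
  have h1 : |Real.sin (pair x θ / 2)| ≤ ∑ i, |(x i : ℝ)| * |Real.sin (θ i / 2)| := by
    have e : pair x θ / 2 = ((x 0 : ℝ) * (θ 0 / 2) + (x 1 : ℝ) * (θ 1 / 2)) +
        ((x 2 : ℝ) * (θ 2 / 2) + (x 3 : ℝ) * (θ 3 / 2)) := by
      unfold pair; rw [Fin.sum_univ_four]; ring
    rw [e, Fin.sum_univ_four]
    refine (abs_sin_add_le' _ _).trans ?_
    have a1 := abs_sin_add_le' ((x 0 : ℝ) * (θ 0 / 2)) ((x 1 : ℝ) * (θ 1 / 2))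
    have a2 := abs_sin_add_le' ((x 2 : ℝ) * (θ 2 / 2)) ((x 3 : ℝ) * (θ 3 / 2))
    linarith [abs_sin_int_mul (x 0) (θ 0 / 2), abs_sin_int_mul (x 1) (θ 1 / 2),
      abs_sin_int_mul (x 2) (θ 2 / 2), abs_sin_int_mul (x 3) (θ 3 / 2)]
  have h2 := Finset.sum_mul_sq_le_sq_mul_sq Finset.univ (fun i => |(x i : ℝ)|)
    (fun i => |Real.sin (θ i / 2)|)
  simp only [sq_abs] at h2
  have h3 : Real.sin (pair x θ / 2) ^ 2 ≤ nsq x * ∑ i, Real.sin (θ i / 2) ^ 2 := by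
    rw [← sq_abs (Real.sin _)]
    exact (pow_le_pow_left₀ (abs_nonneg _) h1 2).trans h2
  have h4 : 4 * (1 - chf θ) = 2 * ∑ i, Real.sin (θ i / 2) ^ 2 := by
    unfold chf
    rw [Fin.sum_univ_four, Fin.sum_univ_four]
    linarith [hs (θ 0), hs (θ 1), hs (θ 2), hs (θ 3)]
  rw [hs, show 4 * nsq x * (1 - chf θ) = nsq x * (4 * (1 - chf θ)) by ring, h4]
  linarith

lemma hk_diff (k : ℕ) (x : Zd 4) :
    hk (2 * k) 0 - 4 * nsq x * (hk (2 * k) 0 - hk (2 * k + 2) 0) ≤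
      hk (2 * k) x + hk (2 * k + 1) x := by
  have e : ∀ θ, pair 0 θ = 0 := fun θ => by simp [pair]
  have hodd := hk_nonneg (2 * k + 1) 0
  suffices h : (hk (2 * k) 0 + hk (2 * k + 1) 0) - 4 * nsq x * (hk (2 * k) 0 - hk (2 * k + 2) 0) ≤
      hk (2 * k) x + hk (2 * k + 1) x by linarith
  have i0 := integrable_basic (2 * k) 0
  have i1 := integrable_basic (2 * k + 1) 0
  have i2 := integrable_basic (2 * k + 2) 0
  have i01 : Integrable (fun θ => chf θ ^ (2 * k) * Real.cos (pair 0 θ) +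
      chf θ ^ (2 * k + 1) * Real.cos (pair 0 θ)) torus := i0.add i1
  have i02 : Integrable (fun θ => 4 * nsq x * (chf θ ^ (2 * k) * Real.cos (pair 0 θ) -
      chf θ ^ (2 * k + 2) * Real.cos (pair 0 θ))) torus := (i0.sub i2).const_mul _
  simp only [hk_fourier]
  rw [← integral_add i0 i1, ← integral_sub i0 i2, ← integral_const_mul,
    ← integral_sub i01 i02,
    ← integral_add (integrable_basic _ _) (integrable_basic _ _)]
  refine integral_mono (i01.sub i02)
    ((integrable_basic _ _).add (integrable_basic _ _)) fun θ => ?_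
  simp only [e, Real.cos_zero, mul_one]
  have h1 := one_sub_cos_le x θ
  have h2 : 0 ≤ chf θ ^ (2 * k) * (1 + chf θ) := by
    have := (abs_le.1 (abs_chf_le θ)).1
    rw [pow_mul]
    exact mul_nonneg (by positivity) (by linarith)
  have h3 := mul_le_mul_of_nonneg_left h1 h2
  rw [pow_add, pow_add, pow_one]
  nlinarith


/-! ### Moments of the walk -/

lemma nsq_add_vec (x : Zd 4) (s : Step) :
    nsq (x + vec s) = nsq x + 2 * (if s.2 then (x s.1 : ℝ) else -(x s.1 : ℝ)) + 1 := by
  rcases s with ⟨i, b⟩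
  fin_cases i <;> cases b <;> simp [nsq, vec, Fin.sum_univ_four, Pi.single_apply] <;> ring

lemma avg_nsq (x : Zd 4) : (1 / 8) * ∑ s : Step, nsq (x + vec s) = nsq x + 1 := by
  simp only [nsq_add_vec, Fintype.sum_prod_type, Fin.sum_univ_four, Fintype.sum_bool]
  simp
  ring

lemma avg_nsq_sq (x : Zd 4) :
    (1 / 8) * ∑ s : Step, nsq (x + vec s) ^ 2 = nsq x ^ 2 + 3 * nsq x + 1 := by
  have h : nsq x = (x 0 : ℝ) ^ 2 + (x 1 : ℝ) ^ 2 + (x 2 : ℝ) ^ 2 + (x 3 : ℝ) ^ 2 := by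
    simp [nsq, Fin.sum_univ_four]
  simp only [nsq_add_vec, Fintype.sum_prod_type, Fin.sum_univ_four, Fintype.sum_bool]
  simp
  rw [h]
  ring

lemma EE_nsq (i : ℕ) (x : Zd 4) : EE i (fun l => nsq (x + tot l)) = nsq x + i := by
  induction i generalizing x with
  | zero => simp [EE_zero]
  | succ i ih =>
    rw [EE_succ]
    simp only [tot_cons, ← add_assoc, ih]
    rw [Finset.sum_add_distrib, mul_add, avg_nsq]
    simp
    ring

lemma EE_nsq_sq (i : ℕ) (x : Zd 4) : EE i (fun l => nsq (x + tot l) ^ 2) =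
    nsq x ^ 2 + 3 * i * nsq x + (3 * i * (i - 1) / 2 + i) := by
  induction i generalizing x with
  | zero => simp [EE_zero]
  | succ i ih =>
    rw [EE_succ]
    simp only [tot_cons, ← add_assoc, ih]
    rw [Finset.sum_add_distrib, Finset.sum_add_distrib, Finset.sum_add_distrib, ← Finset.mul_sum]
    have h1 := avg_nsq x
    have h2 := avg_nsq_sq x
    simp only [Finset.sum_const, Finset.card_univ, Fintype.card_prod, Fintype.card_fin,
      Fintype.card_bool]
    push_cast
    linear_combination h2 + 3 * (i : ℝ) * h1

lemma EE_pos {j r : ℕ} (h : j ≤ r) (F : Zd 4 → ℝ) :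
    EE r (fun l => F (pos l j)) = EE j (fun l => F (tot l)) :=
  EE_take h (fun l => F (tot l))

lemma EE_cov {i j r : ℕ} (hij : i ≤ j) (hj : j ≤ r) :
    EE r (fun l => (nsq (pos l i) - i) * (nsq (pos l j) - j)) ≤ (i : ℝ) ^ 2 := by
  obtain ⟨k, rfl⟩ := Nat.exists_eq_add_of_le hij
  have e1 : EE r (fun l => (nsq (pos l i) - i) * (nsq (pos l (i + k)) - (i + k : ℕ))) =
      EE i (fun u => (nsq (tot u) - i) * (nsq (tot u) - i)) := by
    have := EE_split (k := i) (m := k) (n := r) hj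
      (fun l => (nsq (pos l i) - i) * (nsq (pos l (i + k)) - (i + k : ℕ)))
    simp only [pos_take (Nat.le_add_right i k), pos_take (le_refl (i + k))] at this
    rw [← this]
    refine EE_congr fun u hu => ?_
    have : ∀ v, (nsq (pos (u ++ v) i) - i) * (nsq (pos (u ++ v) (i + k)) - (i + k : ℕ)) =
        (nsq (tot u) - i) * (nsq (tot u + pos v k) - (i + k : ℕ)) := by
      intro v
      rw [pos_append_left hu.ge, pos_append_right' hu, pos_length hu.le]
    simp only [this]
    rw [EE_mul_left, EE_sub, EE_const]
    rw [show EE k (fun l => nsq (tot u + pos l k)) = nsq (tot u) + k from ?_]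
    · push_cast; ring
    · rw [EE_pos le_rfl (fun x => nsq (tot u + x)), EE_nsq]
  rw [e1]
  have e2 : ∀ u, (nsq (tot u) - i) * (nsq (tot u) - i) =
      (nsq (0 + tot u) ^ 2 - (2 * i) * nsq (0 + tot u)) + i ^ 2 := by
    intro u; rw [zero_add]; ring
  simp only [e2]
  rw [EE_add, EE_sub, EE_mul_left, EE_nsq, EE_nsq_sq, EE_const]
  have : nsq 0 = 0 := by simp [nsq]
  rw [this]
  have : (0 : ℝ) ≤ i := by positivity
  nlinarith

/-- Harmonic numbers. -/
def Hm (m : ℕ) : ℝ := ∑ j ∈ Finset.Icc 1 m, 1 / (j : ℝ)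

/-- Weighted sum of squares. -/
def Ws (m : ℕ) (l : List Step) : ℝ := ∑ j ∈ Finset.Icc 1 m, nsq (pos l j) / (j : ℝ) ^ 2

lemma log_le_Hm (m : ℕ) : Real.log (m + 1) ≤ Hm m := by
  have h := log_add_one_le_harmonic m
  rw [harmonic_eq_sum_Icc] at h
  push_cast at h
  unfold Hm
  simpa [one_div] using h

lemma EE_Ws_var {m r : ℕ} (h : m ≤ r) : EE r (fun l => (Ws m l - Hm m) ^ 2) ≤ 2 * Hm m := by
  have e : ∀ l, (Ws m l - Hm m) ^ 2 = ∑ i ∈ Finset.Icc 1 m, ∑ j ∈ Finset.Icc 1 m,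
      (1 / ((i : ℝ) ^ 2 * (j : ℝ) ^ 2)) * ((nsq (pos l i) - i) * (nsq (pos l j) - j)) := by
    intro l
    have : Ws m l - Hm m = ∑ j ∈ Finset.Icc 1 m, (nsq (pos l j) - j) / (j : ℝ) ^ 2 := by
      unfold Ws Hm
      rw [← Finset.sum_sub_distrib]
      refine Finset.sum_congr rfl fun j hj => ?_
      have : (j : ℝ) ≠ 0 := by
        have := (Finset.mem_Icc.1 hj).1
        positivity
      field_simp
    rw [this, sq, Finset.sum_mul_sum]
    refine Finset.sum_congr rfl fun i _ => Finset.sum_congr rfl fun j _ => ?_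
    rw [div_mul_div_comm, one_div_mul_eq_div]
  simp only [e]
  rw [EE_sum]
  simp only [EE_sum, EE_mul_left]
  have key : ∀ i ∈ Finset.Icc 1 m, ∀ j ∈ Finset.Icc 1 m,
      (1 / ((i : ℝ) ^ 2 * (j : ℝ) ^ 2)) * EE r (fun l => (nsq (pos l i) - i) * (nsq (pos l j) - j))
      ≤ (if i ≤ j then 1 / (j : ℝ) ^ 2 else 0) + (if j ≤ i then 1 / (i : ℝ) ^ 2 else 0) := by
    have aux : ∀ i ∈ Finset.Icc 1 m, ∀ j ∈ Finset.Icc 1 m, i ≤ j →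
      (1 / ((i : ℝ) ^ 2 * (j : ℝ) ^ 2)) * EE r (fun l => (nsq (pos l i) - i) * (nsq (pos l j) - j))
        ≤ 1 / (j : ℝ) ^ 2 := by
      intro i hi j hj hij
      rw [Finset.mem_Icc] at hi hj
      have hi' : (0 : ℝ) < i := by exact_mod_cast hi.1
      have hj' : (0 : ℝ) < j := by exact_mod_cast hj.1
      calc _ ≤ (1 / ((i : ℝ) ^ 2 * (j : ℝ) ^ 2)) * (i : ℝ) ^ 2 := by
            gcongr
            exact EE_cov hij (hj.2.trans h)
        _ = _ := by field_simp
    intro i hi j hj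
    rcases le_total i j with hij | hij
    · rw [if_pos hij]
      have := aux i hi j hj hij
      split_ifs
      · have : (0 : ℝ) ≤ 1 / (i : ℝ) ^ 2 := by positivity
        linarith
      · linarith
    · rw [if_pos hij]
      have := aux j hj i hi hij
      simp only [mul_comm] at this ⊢
      split_ifs
      · have : (0 : ℝ) ≤ 1 / (j : ℝ) ^ 2 := by positivity
        linarith
      · linarith
  refine (Finset.sum_le_sum fun i hi => Finset.sum_le_sum fun j hj => key i hi j hj).trans ?_
  simp only [Finset.sum_add_distrib]
  rw [Finset.sum_comm]
  have s : ∑ y ∈ Finset.Icc 1 m, ∑ x ∈ Finset.Icc 1 m, (if x ≤ y then 1 / (y : ℝ) ^ 2 else 0) ≤ Hm m := by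
    unfold Hm
    refine Finset.sum_le_sum fun y hy => ?_
    rw [← Finset.sum_filter, Finset.sum_const, nsmul_eq_mul]
    have hy' : (0 : ℝ) < y := by exact_mod_cast (Finset.mem_Icc.1 hy).1
    have hc : (((Finset.Icc 1 m).filter (fun x => x ≤ y)).card : ℝ) ≤ y := by
      have : (Finset.Icc 1 m).filter (fun x => x ≤ y) ⊆ Finset.Icc 1 y := by
        intro x hx; simp only [Finset.mem_filter, Finset.mem_Icc] at hx ⊢; omega
      have := Finset.card_le_card this
      rw [Nat.card_Icc] at this
      exact_mod_cast this
    calc _ ≤ (y : ℝ) * (1 / (y : ℝ) ^ 2) := by gcongr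
      _ = _ := by field_simp
  linarith

lemma EE_Ws_tail {m r : ℕ} (h : m ≤ r) (hm : 0 < Hm m) :
    EE r (fun l => ind (2 * Hm m ≤ Ws m l)) ≤ 2 / Hm m := by
  have h1 : EE r (fun l => ind (2 * Hm m ≤ Ws m l)) ≤
      EE r (fun l => (1 / Hm m ^ 2) * (Ws m l - Hm m) ^ 2) := by
    refine EE_mono fun l _ => ?_
    by_cases hl : 2 * Hm m ≤ Ws m l
    · rw [ind_true hl, one_div_mul_eq_div, le_div_iff₀ (by positivity)]
      nlinarith
    · rw [ind_false hl]; positivity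
  rw [EE_mul_left] at h1
  refine h1.trans ?_
  calc _ ≤ (1 / Hm m ^ 2) * (2 * Hm m) := by gcongr; exact EE_Ws_var h
    _ = _ := by field_simp

/-! ### Truncated Green function -/

/-- Truncated Green function. -/
def gr (r : ℕ) (x : Zd 4) : ℝ := ∑ k ∈ Finset.range (r + 1), hk k x

/-- Sum of the Green's function along a path. -/
def Gn (r : ℕ) (l : List Step) : ℝ := ∑ j ∈ Finset.range (r + 1), gr r (pos l j)

lemma gr_nonneg (r : ℕ) (x : Zd 4) : 0 ≤ gr r x := Finset.sum_nonneg fun _ _ => hk_nonneg _ _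

lemma gr_neg (r : ℕ) (x : Zd 4) : gr r (-x) = gr r x := by simp only [gr, hk_neg]

lemma sum_pairs (f : ℕ → ℝ) (b : ℕ) :
    ∑ k ∈ Finset.range b, (f (2 * k) + f (2 * k + 1)) = ∑ k ∈ Finset.range (2 * b), f k := by
  induction b with
  | zero => simp
  | succ b ih =>
    rw [Finset.sum_range_succ, ih, show 2 * (b + 1) = 2 * b + 1 + 1 by ring,
      Finset.sum_range_succ, Finset.sum_range_succ]
    ring

lemma sum_inv_sq_ge {a b : ℕ} (ha : 0 < a) (hab : a ≤ b) :
    1 / (a : ℝ) - 1 / b ≤ ∑ k ∈ Finset.Ico a b, 1 / (k : ℝ) ^ 2 := by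
  induction b, hab using Nat.le_induction with
  | base => simp
  | succ b hab ih =>
    rw [Finset.sum_Ico_succ_top hab]
    have hb : (0 : ℝ) < b := by exact_mod_cast ha.trans_le hab
    have : 1 / (b : ℝ) - 1 / ((b + 1 : ℕ) : ℝ) ≤ 1 / (b : ℝ) ^ 2 := by
      push_cast
      rw [div_sub_div _ _ hb.ne' (by positivity), div_le_div_iff₀ (by positivity) (by positivity)]
      nlinarith
    linarith

/-- The constant in the heat kernel lower bound. -/
def c0 : ℝ := (1 / 4) * (1 / Real.pi ^ 4)

lemma c0_pos : 0 < c0 := by unfold c0; have := Real.pi_pos; positivity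

lemma gr_lower {a b r : ℕ} (ha : 0 < a) (hab : 2 * a ≤ b) (hbr : 2 * b ≤ r + 1) (x : Zd 4) :
    c0 / (2 * a) - 10000 * nsq x / (a : ℝ) ^ 2 ≤ gr r x := by
  have ha' : (0 : ℝ) < a := by exact_mod_cast ha
  have hb' : (0 : ℝ) < b := by exact_mod_cast (by omega : 0 < b)
  have h1 : ∑ k ∈ Finset.Ico a b, (hk (2 * k) x + hk (2 * k + 1) x) ≤ gr r x := by
    calc _ ≤ ∑ k ∈ Finset.range b, (hk (2 * k) x + hk (2 * k + 1) x) := by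
          refine Finset.sum_le_sum_of_subset_of_nonneg ?_ fun k _ _ =>
            add_nonneg (hk_nonneg _ _) (hk_nonneg _ _)
          intro k hk; simp only [Finset.mem_Ico, Finset.mem_range] at hk ⊢; omega
      _ = ∑ k ∈ Finset.range (2 * b), hk k x := sum_pairs (fun k => hk k x) b
      _ ≤ _ := by
          refine Finset.sum_le_sum_of_subset_of_nonneg ?_ fun k _ _ => hk_nonneg _ _
          exact Finset.range_mono hbr
  have h2 : ∑ k ∈ Finset.Ico a b, (hk (2 * k) 0 - 4 * nsq x * (hk (2 * k) 0 - hk (2 * k + 2) 0)) ≤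
      ∑ k ∈ Finset.Ico a b, (hk (2 * k) x + hk (2 * k + 1) x) :=
    Finset.sum_le_sum fun k _ => hk_diff k x
  rw [Finset.sum_sub_distrib, ← Finset.mul_sum] at h2
  have h3 : ∑ k ∈ Finset.Ico a b, (hk (2 * k) 0 - hk (2 * k + 2) 0) = hk (2 * a) 0 - hk (2 * b) 0 := by
    have := Finset.sum_Ico_sub (fun k => - hk (2 * k) 0) (by omega : a ≤ b)
    simp only [mul_add, mul_one] at this
    rw [show hk (2 * a) 0 - hk (2 * b) 0 = - hk (2 * b) 0 - - hk (2 * a) 0 by ring, ← this]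
    exact Finset.sum_congr rfl fun k _ => by ring
  have h4 : c0 * (1 / (a : ℝ) - 1 / b) ≤ ∑ k ∈ Finset.Ico a b, hk (2 * k) 0 := by
    calc _ ≤ c0 * ∑ k ∈ Finset.Ico a b, 1 / (k : ℝ) ^ 2 := by
          have := c0_pos
          gcongr
          exact sum_inv_sq_ge ha (by omega)
      _ ≤ _ := by
          rw [Finset.mul_sum]
          refine Finset.sum_le_sum fun k hk' => ?_
          have := hk_lower k (ha.trans_le (Finset.mem_Ico.1 hk').1)
          rw [mul_one_div]
          exact this
  have h5 : hk (2 * a) 0 - hk (2 * b) 0 ≤ 10000 / (2 * (a : ℝ)) ^ 2 := by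
    have := hk_upper (2 * a) (by omega)
    push_cast at this
    linarith [hk_nonneg (2 * b) 0]
  have h6 : 1 / (2 * (a : ℝ)) ≤ 1 / (a : ℝ) - 1 / b := by
    have : 1 / (b : ℝ) ≤ 1 / (2 * (a : ℝ)) := by
      gcongr
      exact_mod_cast hab
    have e : 1 / (a : ℝ) = 1 / (2 * (a : ℝ)) + 1 / (2 * (a : ℝ)) := by field_simp; norm_num
    linarith
  have h7 : c0 / (2 * a) ≤ c0 * (1 / (a : ℝ) - 1 / b) := by
    rw [← mul_one_div]
    exact mul_le_mul_of_nonneg_left h6 c0_pos.le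
  have h8 : 4 * nsq x * (hk (2 * a) 0 - hk (2 * b) 0) ≤ 10000 * nsq x / (a : ℝ) ^ 2 := by
    have := nsq_nonneg x
    calc _ ≤ 4 * nsq x * (10000 / (2 * (a : ℝ)) ^ 2) := by gcongr
      _ = _ := by field_simp; ring
  rw [h3] at h2
  linarith

lemma Gn_lower {M m b r : ℕ} (hM : 0 < M) (hm : 2 * (M * m) ≤ b) (hbr : 2 * b ≤ r + 1)
    (l : List Step) :
    c0 / (2 * M) * Hm m - 10000 / (M : ℝ) ^ 2 * Ws m l ≤ Gn r l := by
  have hM' : (0 : ℝ) < M := by exact_mod_cast hM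
  have h1 : ∑ j ∈ Finset.Icc 1 m, gr r (pos l j) ≤ Gn r l := by
    refine Finset.sum_le_sum_of_subset_of_nonneg ?_ fun _ _ _ => gr_nonneg _ _
    intro j hj
    simp only [Finset.mem_Icc, Finset.mem_range] at hj ⊢
    have : m ≤ M * m := Nat.le_mul_of_pos_left m hM
    omega
  refine le_trans ?_ h1
  unfold Hm Ws
  rw [Finset.mul_sum, Finset.mul_sum, ← Finset.sum_sub_distrib]
  refine Finset.sum_le_sum fun j hj => ?_
  rw [Finset.mem_Icc] at hj
  have hj' : (0 : ℝ) < j := by exact_mod_cast hj.1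
  have := gr_lower (a := M * j) (b := b) (r := r) (Nat.mul_pos hM hj.1)
    (le_trans (by gcongr; exact hj.2) hm) hbr (pos l j)
  refine le_trans (le_of_eq ?_) this
  push_cast
  field_simp

lemma Gn_bad : ∃ c > 0, ∃ C > 0, ∃ r0 : ℕ, ∀ r ≥ r0,
    EE r (fun l => ind (Gn r l < c * Real.log r)) ≤ C / Real.log r := by
  obtain ⟨M, hM⟩ := exists_nat_ge (80000 / c0)
  have hc := c0_pos
  have hM' : (0 : ℝ) < M := lt_of_lt_of_le (by positivity) hM
  have hM0 : 0 < M := by exact_mod_cast hM'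
  have hM1 : (1 : ℝ) ≤ M := by exact_mod_cast hM0
  refine ⟨c0 / (8 * M), by positivity, 4, by norm_num, (4 * M) ^ 2, fun r hr => ?_⟩
  set b := (r + 1) / 2 with hb
  set m := b / (2 * M) with hm
  have hbr : 2 * b ≤ r + 1 := by omega
  have hmb : 2 * (M * m) ≤ b := by
    rw [← mul_assoc]; exact Nat.mul_div_le b (2 * M)
  have hr4 : r ≤ 4 * M * (m + 1) := by
    have h1 : b < 2 * M * (m + 1) := Nat.lt_mul_div_succ b (by omega)
    have : 4 * M * (m + 1) = 2 * (2 * M * (m + 1)) := by ring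
    omega
  have hrR : ((4 * M : ℝ)) ^ 2 ≤ r := by exact_mod_cast hr
  have hr0 : (0 : ℝ) < r := lt_of_lt_of_le (by positivity) hrR
  have hr1 : (1 : ℝ) < r := by nlinarith
  have hlog : 0 < Real.log r := Real.log_pos hr1
  have hH : Real.log r / 2 ≤ Hm m := by
    refine le_trans ?_ (log_le_Hm m)
    have h1 : Real.log r ≤ Real.log (4 * M) + Real.log (m + 1) := by
      rw [← Real.log_mul (by positivity) (by positivity)]
      exact Real.log_le_log hr0 (by exact_mod_cast hr4)
    have h2 : 2 * Real.log (4 * M) ≤ Real.log r := by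
      have := Real.log_le_log (by positivity) hrR
      rw [Real.log_pow] at this
      exact_mod_cast this
    linarith
  have hHpos : 0 < Hm m := by linarith
  have hmr : m ≤ r := by
    have : m ≤ M * m := Nat.le_mul_of_pos_left m hM0
    omega
  calc EE r (fun l => ind (Gn r l < c0 / (8 * M) * Real.log r))
      ≤ EE r (fun l => ind (2 * Hm m ≤ Ws m l)) := by
        refine EE_mono fun l _ => ind_mono fun hl => ?_
        by_contra hcon
        push Not at hcon
        have h1 := Gn_lower hM0 hmb hbr l
        have h2 : 10000 / (M : ℝ) ^ 2 * Ws m l ≤ 10000 / (M : ℝ) ^ 2 * (2 * Hm m) := by gcongr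
        have h3 : 10000 / (M : ℝ) ^ 2 * 2 ≤ c0 / (4 * M) := by
          rw [div_le_iff₀ hc] at hM
          rw [div_mul_eq_mul_div, div_le_div_iff₀ (by positivity) (by positivity)]
          nlinarith
        have h4 : 10000 / (M : ℝ) ^ 2 * 2 * Hm m ≤ c0 / (4 * M) * Hm m := by gcongr
        have h5 : c0 / (2 * M) * Hm m = c0 / (4 * M) * Hm m + c0 / (4 * M) * Hm m := by
          field_simp; norm_num
        have h6 : c0 / (8 * M) * Real.log r = c0 / (4 * M) * (Real.log r / 2) := by
          field_simp; norm_num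
        have h7 : c0 / (4 * M) * (Real.log r / 2) ≤ c0 / (4 * M) * Hm m := by gcongr
        linarith
    _ ≤ 2 / Hm m := EE_Ws_tail hmr hHpos
    _ ≤ 2 / (Real.log r / 2) := by gcongr
    _ = 4 / Real.log r := by field_simp; norm_num


/-! ### Local times -/

lemma hk_sum_le {a b : ℕ} (ha : 0 < a) (hab : a ≤ b) :
    ∑ k ∈ Finset.Ico a b, hk k 0 ≤ 20000 * (1 / (a : ℝ) - 1 / b) := by
  induction b, hab using Nat.le_induction with
  | base => simp
  | succ b hab ih =>
    rw [Finset.sum_Ico_succ_top hab]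
    have hb : (0 : ℝ) < b := by exact_mod_cast ha.trans_le hab
    have hb1 : (1 : ℝ) ≤ b := by exact_mod_cast ha.trans_le hab
    have h1 := hk_upper b (ha.trans_le hab)
    have : 10000 / (b : ℝ) ^ 2 ≤ 20000 * (1 / (b : ℝ) - 1 / ((b + 1 : ℕ) : ℝ)) := by
      push_cast
      rw [div_sub_div _ _ hb.ne' (by positivity), ← mul_div_assoc,
        div_le_div_iff₀ (by positivity) (by positivity)]
      nlinarith
    linarith

lemma hk_sum_le' {a b : ℕ} (ha : 0 < a) : ∑ k ∈ Finset.Ico a b, hk k 0 ≤ 20000 / (a : ℝ) := by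
  have ha' : (0 : ℝ) < a := by exact_mod_cast ha
  rcases le_total a b with h | h
  · have := hk_sum_le ha h
    have hb : (0 : ℝ) ≤ 1 / (b : ℝ) := by positivity
    calc _ ≤ _ := this
      _ ≤ 20000 * (1 / (a : ℝ)) := by linarith
      _ = _ := by ring
  · rw [Finset.Ico_eq_empty_of_le h, Finset.sum_empty]; positivity

/-- Number of returns to the origin in the first `n` steps. -/
def Vis (n : ℕ) (l : List Step) : ℕ := ∑ j ∈ Finset.range n, if pos l (j + 1) = 0 then 1 else 0

lemma choose_sum (e : ℕ → ℕ) (he : ∀ j, e j = 0 ∨ e j = 1) (m n i : ℕ) :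
    (∑ j ∈ Finset.Ico i (i + n), e j).choose (m + 1) =
      ∑ k ∈ Finset.Ico i (i + n), e k * (∑ j ∈ Finset.Ico (k + 1) (i + n), e j).choose m := by
  induction n generalizing i with
  | zero => simp
  | succ n ih =>
    have hlt : i < i + (n + 1) := by omega
    rw [Finset.sum_eq_sum_Ico_succ_bot hlt e, Finset.sum_eq_sum_Ico_succ_bot hlt
      (fun k => e k * (∑ j ∈ Finset.Ico (k + 1) (i + (n + 1)), e j).choose m)]
    have := ih (i + 1)
    rw [show i + 1 + n = i + (n + 1) by ring] at this
    rcases he i with h | h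
    · rw [h, zero_add, zero_mul, zero_add, this]
    · rw [h, one_mul, ← this, add_comm 1, Nat.choose_succ_succ]

lemma EE_choose (m N : ℕ) : EE N (fun l => ((Vis N l).choose m : ℝ)) ≤ 20000 ^ m := by
  induction m generalizing N with
  | zero => simp [EE_const]
  | succ m ih =>
    have e1 : ∀ l, ((Vis N l).choose (m + 1) : ℝ) = ∑ k ∈ Finset.range N,
        ind (pos l (k + 1) = 0) * ((∑ j ∈ Finset.range (N - (k + 1)),
          if pos l ((k + 1) + j + 1) = 0 then 1 else 0 : ℕ).choose m : ℝ) := by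
      intro l
      have := choose_sum (fun j => if pos l (j + 1) = 0 then 1 else 0)
        (fun j => by by_cases h : pos l (j + 1) = 0 <;> simp [h]) m N 0
      simp only [zero_add, ← Finset.range_eq_Ico] at this
      rw [Vis, this]
      push_cast
      refine Finset.sum_congr rfl fun k _ => ?_
      rw [Finset.sum_Ico_eq_sum_range]
      congr 1
      simp [ind]
    simp only [e1]
    rw [EE_sum]
    have e2 : ∀ k ∈ Finset.range N, EE N (fun l => ind (pos l (k + 1) = 0) *
        ((∑ j ∈ Finset.range (N - (k + 1)),
          if pos l ((k + 1) + j + 1) = 0 then 1 else 0 : ℕ).choose m : ℝ)) ≤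
        hk (k + 1) 0 * 20000 ^ m := by
      intro k hk'
      rw [Finset.mem_range] at hk'
      have hN : N = (k + 1) + (N - (k + 1)) := by omega
      conv_lhs => rw [hN, EE_append]
      rw [hk, ← EE_mul_right]
      refine EE_mono fun u hu => ?_
      by_cases h0 : tot u = 0
      · rw [ind_true h0, one_mul]
        refine le_trans (le_of_eq (EE_congr fun v hv => ?_)) (ih (N - (k + 1)))
        rw [pos_append_left hu.ge, pos_length hu.le, ind_true h0, one_mul,
          show k + 1 + (N - (k + 1)) - (k + 1) = N - (k + 1) by omega, Vis]
        simp only [add_assoc]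
        simp only [← add_assoc k 1, pos_append_right' hu, h0, zero_add]
      · rw [ind_false h0, zero_mul]
        refine le_of_eq ((EE_congr fun v hv => ?_).trans (EE_const _ 0))
        rw [pos_append_left hu.ge, pos_length hu.le, ind_false h0, zero_mul]
    refine (Finset.sum_le_sum e2).trans ?_
    rw [← Finset.sum_mul, pow_succ, mul_comm]
    gcongr
    have := hk_sum_le' (a := 1) (b := N + 1) one_pos
    rw [Finset.sum_Ico_eq_sum_range] at this
    simp only [Nat.add_sub_cancel, add_comm 1] at this
    simpa using this

lemma Vis_tail {N r : ℕ} (hN : N ≤ r) {K : ℝ} (hK : 0 < K) :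
    EE r (fun l => ind (K + 4 ≤ (Vis N l : ℝ))) ≤ 120 * 20000 ^ 5 / K ^ 5 := by
  have h0 : EE r (fun l => ind (K + 4 ≤ (Vis N l : ℝ))) =
      EE N (fun l => ind (K + 4 ≤ (Vis N l : ℝ))) := by
    rw [← EE_take hN]
    refine EE_congr fun l _ => ?_
    have : Vis N l = Vis N (l.take N) := by
      unfold Vis
      refine Finset.sum_congr rfl fun j hj => ?_
      rw [pos_take (by rw [Finset.mem_range] at hj; omega)]
    rw [this]
  rw [h0]
  have h1 : EE N (fun l => ind (K + 4 ≤ (Vis N l : ℝ))) ≤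
      EE N (fun l => (120 / K ^ 5) * ((Vis N l).choose 5 : ℝ)) := by
    refine EE_mono fun l _ => ?_
    by_cases h : K + 4 ≤ (Vis N l : ℝ)
    · rw [ind_true h, div_mul_eq_mul_div, le_div_iff₀ (by positivity), one_mul]
      have h4 : 4 ≤ Vis N l := by
        have : (4 : ℝ) ≤ Vis N l := by linarith
        exact_mod_cast this
      have h3 : (Vis N l - 4) ^ 5 ≤ 120 * (Vis N l).choose 5 := by
        have := Nat.pow_sub_le_descFactorial (Vis N l) 5
        rw [Nat.descFactorial_eq_factorial_mul_choose] at this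
        rw [show Vis N l + 1 - 5 = Vis N l - 4 by omega] at this
        exact this
      have h5 : ((Vis N l : ℝ) - 4) ^ 5 ≤ 120 * (Vis N l).choose 5 := by
        have : (((Vis N l - 4 : ℕ) : ℝ)) ^ 5 ≤ 120 * (Vis N l).choose 5 := by exact_mod_cast h3
        rwa [Nat.cast_sub h4] at this
      refine le_trans ?_ h5
      gcongr
      linarith
    · rw [ind_false h]; positivity
  rw [EE_mul_left] at h1
  refine h1.trans ?_
  calc _ ≤ (120 / K ^ 5) * 20000 ^ 5 := by gcongr; exact EE_choose 5 N
    _ = _ := by ring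


/-! ### The last exit inequality -/

lemma sum_ind_le {ι : Type*} (s : Finset ι) (p : ι → Prop) (q : Prop)
    (h1 : ∀ i ∈ s, ∀ j ∈ s, p i → p j → i = j) (h2 : ∀ i ∈ s, p i → q) :
    ∑ i ∈ s, ind (p i) ≤ ind q := by
  by_cases h : ∃ i ∈ s, p i
  · obtain ⟨i, hi, hp⟩ := h
    rw [ind_true (h2 i hi hp), Finset.sum_eq_single_of_mem i hi]
    · exact ind_le_one _
    · intro j hj hne
      exact ind_false fun hpj => hne (h1 j hj i hi hpj hp)
  · push Not at h
    rw [Finset.sum_eq_zero fun i hi => ind_false (h i hi)]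
    exact ind_nonneg _

/-- Probability to avoid `A` up to time `n` and hit `B` between times `n` and `N`. -/
def phi (n N : ℕ) (A : Finset (Zd 4)) (B : Set (Zd 4)) (x : Zd 4) : ℝ :=
  EE N (fun w => ind ((∀ s, 1 ≤ s → s ≤ n → x + pos w s ∉ A) ∧ ∃ s, n ≤ s ∧ s ≤ N ∧ x + pos w s ∈ B))

/-- Probability to hit `B` between times `n` and `N`. -/
def psi (n N : ℕ) (B : Set (Zd 4)) (y : Zd 4) : ℝ :=
  EE N (fun w => ind (∃ s, n ≤ s ∧ s ≤ N ∧ y + pos w s ∈ B))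

lemma phi_nonneg (n N : ℕ) (A : Finset (Zd 4)) (B : Set (Zd 4)) (x : Zd 4) : 0 ≤ phi n N A B x :=
  EE_nonneg fun _ _ => ind_nonneg _

lemma phi_le_one (n N : ℕ) (A : Finset (Zd 4)) (B : Set (Zd 4)) (x : Zd 4) : phi n N A B x ≤ 1 :=
  EE_le_one fun _ _ => ind_le_one _

lemma last_exit (n N : ℕ) (hnN : n ≤ N) (A : Finset (Zd 4)) (B : Set (Zd 4)) (y : Zd 4) :
    ∑ x ∈ A, gr n (x - y) * phi n N A B x ≤ psi n (N + n) B y := by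
  set Ev : ℕ → List Step → Prop := fun k l => y + pos l k ∈ A ∧
    (∀ s, 1 ≤ s → s ≤ n → y + pos l (k + s) ∉ A) ∧ ∃ s, n ≤ s ∧ s ≤ N ∧ y + pos l (k + s) ∈ B with hEv
  have step : ∀ k ∈ Finset.range (n + 1), ∑ x ∈ A, hk k (x - y) * phi n N A B x ≤
      EE (N + n) (fun l => ind (Ev k l)) := by
    intro k hk'
    rw [Finset.mem_range] at hk'
    have e1 : ∑ x ∈ A, hk k (x - y) * phi n N A B x =
        EE k (fun u => ∑ x ∈ A, ind (tot u = x - y) * phi n N A B x) := by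
      rw [EE_sum]
      simp only [EE_mul_right]
      rfl
    have e2 : EE (N + n) (fun l => ind (Ev k l)) =
        EE k (fun u => EE N (fun v => ind (Ev k (u ++ v)))) := by
      rw [EE_split (n := N + n) (by omega) (fun l => ind (Ev k l))]
      refine EE_congr fun l _ => ind_congr ?_
      simp only [hEv]
      rw [pos_take (by omega)]
      refine and_congr Iff.rfl (and_congr ?_ ?_)
      · refine forall_congr' fun s => forall_congr' fun _ => forall_congr' fun hs => ?_
        rw [pos_take (by omega)]
      · refine exists_congr fun s => and_congr Iff.rfl (and_congr_right fun hs => ?_)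
        rw [pos_take (by omega)]
    rw [e1, e2]
    refine EE_mono fun u hu => ?_
    by_cases hA : y + tot u ∈ A
    · rw [Finset.sum_eq_single_of_mem _ hA]
      · rw [ind_true (by abel), one_mul, phi]
        refine EE_mono fun v _ => ind_mono fun hv => ?_
        simp only [hEv, pos_append_left hu.ge, pos_length hu.le, pos_append_right' hu, ← add_assoc]
        exact ⟨hA, hv⟩
      · intro x _ hx
        rw [ind_false, zero_mul]
        intro h
        apply hx
        rw [h]; abel
    · rw [Finset.sum_eq_zero]
      · exact EE_nonneg fun _ _ => ind_nonneg _
      · intro x hx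
        rw [ind_false, zero_mul]
        intro h
        apply hA
        rw [h]
        convert hx using 1
        abel
  calc ∑ x ∈ A, gr n (x - y) * phi n N A B x
      = ∑ k ∈ Finset.range (n + 1), ∑ x ∈ A, hk k (x - y) * phi n N A B x := by
        rw [Finset.sum_comm]
        refine Finset.sum_congr rfl fun x _ => ?_
        rw [gr, Finset.sum_mul]
    _ ≤ ∑ k ∈ Finset.range (n + 1), EE (N + n) (fun l => ind (Ev k l)) := Finset.sum_le_sum step
    _ = EE (N + n) (fun l => ∑ k ∈ Finset.range (n + 1), ind (Ev k l)) := (EE_sum _ _ _).symm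
    _ ≤ _ := by
        refine EE_mono fun l _ => sum_ind_le _ _ _ ?_ ?_
        · have aux : ∀ i j, i < j → j ≤ n → Ev i l → Ev j l → False := by
            intro i j hij hj hi hj'
            have := hi.2.1 (j - i) (by omega) (by omega)
            rw [show i + (j - i) = j by omega] at this
            exact this hj'.1
          intro i hi j hj hpi hpj
          rw [Finset.mem_range] at hi hj
          rcases lt_trichotomy i j with h | h | h
          · exact (aux i j h (by omega) hpi hpj).elim
          · exact h
          · exact (aux j i h (by omega) hpj hpi).elim
        · intro i hi hp
          rw [Finset.mem_range] at hi
          obtain ⟨s, hs1, hs2, hs3⟩ := hp.2.2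
          exact ⟨i + s, by omega, by omega, hs3⟩

/-! ### The hitting bound -/

lemma hit_lem (n N r : ℕ) (f : Zd 4 → ℝ) (hf : ∀ x, 0 ≤ f x) (D : Set (Zd 4)) (c : ℝ)
    (hD : ∀ x ∈ D, c ≤ ∑ k ∈ Finset.range (r + 1), EE k (fun w => f (x + tot w))) :
    c * EE N (fun w => ind (∃ s, n ≤ s ∧ s ≤ N ∧ pos w s ∈ D)) ≤
      ∑ s ∈ Finset.Icc n (N + r), EE s (fun w => f (tot w)) := by
  set Fi : ℕ → List Step → Prop := fun s l => pos l s ∈ D ∧ ∀ s', n ≤ s' → s' < s → pos l s' ∉ D with hFi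
  have hFt : ∀ s m l, s ≤ m → (Fi s (l.take m) ↔ Fi s l) := by
    intro s m l hs
    simp only [hFi]
    rw [pos_take hs]
    refine and_congr Iff.rfl (forall_congr' fun s' => forall_congr' fun _ => forall_congr' fun h => ?_)
    rw [pos_take (by omega)]
  have hdis : ∀ l, ∀ i ∈ Finset.Icc n N, ∀ j ∈ Finset.Icc n N, Fi i l → Fi j l → i = j := by
    intro l i hi j hj h1 h2
    rw [Finset.mem_Icc] at hi hj
    rcases lt_trichotomy i j with h | h | h
    · exact (h2.2 i hi.1 h h1.1).elim
    · exact h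
    · exact (h1.2 j hj.1 h h2.1).elim
  have h1 : c * EE N (fun w => ind (∃ s, n ≤ s ∧ s ≤ N ∧ pos w s ∈ D)) =
      ∑ s ∈ Finset.Icc n N, EE s (fun u => ind (Fi s u) * c) := by
    have : ∀ w, ind (∃ s, n ≤ s ∧ s ≤ N ∧ pos w s ∈ D) = ∑ s ∈ Finset.Icc n N, ind (Fi s w) := by
      intro w
      refine le_antisymm ?_ ?_
      · refine le_trans (ind_mono ?_) (ind_exists_le _ _)
        intro h
        have hs := Nat.find_spec h
        refine ⟨Nat.find h, Finset.mem_Icc.2 ⟨hs.1, hs.2.1⟩, hs.2.2, fun s' h1 h2 h3 => ?_⟩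
        exact Nat.find_min h h2 ⟨h1, by omega, h3⟩
      · refine sum_ind_le _ _ _ (hdis w) ?_
        intro i hi hp
        rw [Finset.mem_Icc] at hi
        exact ⟨i, hi.1, hi.2, hp.1⟩
    simp only [this]
    rw [EE_sum, Finset.mul_sum]
    refine Finset.sum_congr rfl fun s hs => ?_
    rw [Finset.mem_Icc] at hs
    rw [EE_mul_right, mul_comm, ← EE_take hs.2]
    congr 1
    exact EE_congr fun l _ => ind_congr (hFt s s l le_rfl).symm
  rw [h1]
  have h2 : ∀ s ∈ Finset.Icc n N, EE s (fun u => ind (Fi s u) * c) ≤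
      ∑ k ∈ Finset.range (r + 1), EE (N + r) (fun l => ind (Fi s l) * f (pos l (s + k))) := by
    intro s hs
    rw [Finset.mem_Icc] at hs
    have : ∀ k ∈ Finset.range (r + 1), EE (N + r) (fun l => ind (Fi s l) * f (pos l (s + k))) =
        EE s (fun u => ind (Fi s u) * EE k (fun w => f (tot u + tot w))) := by
      intro k hk'
      rw [Finset.mem_range] at hk'
      have := EE_split (k := s) (m := k) (n := N + r) (by omega)
        (fun l => ind (Fi s l) * f (pos l (s + k)))
      simp only [pos_take (le_refl (s + k)), ind_congr (hFt s (s + k) _ (by omega))] at this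
      rw [← this]
      refine EE_congr fun u hu => ?_
      rw [← EE_mul_left]
      refine EE_congr fun v hv => ?_
      rw [pos_append_right' hu, pos_length hv.le]
      congr 1
      refine ind_congr ?_
      rw [← hFt s s (u ++ v) le_rfl, List.take_append_of_le_length hu.ge, List.take_of_length_le hu.le]
    rw [Finset.sum_congr rfl this, ← EE_sum]
    refine EE_mono fun u hu => ?_
    rw [← Finset.mul_sum]
    by_cases h : Fi s u
    · rw [ind_true h, one_mul, one_mul]
      have := h.1
      rw [pos_length hu.le] at this
      exact hD _ this
    · rw [ind_false h, zero_mul, zero_mul]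
  refine (Finset.sum_le_sum h2).trans ?_
  have h3 : ∑ s ∈ Finset.Icc n (N + r), EE s (fun w => f (tot w)) =
      EE (N + r) (fun l => ∑ s ∈ Finset.Icc n (N + r), f (pos l s)) := by
    rw [EE_sum]
    exact Finset.sum_congr rfl fun s hs => (EE_pos (Finset.mem_Icc.1 hs).2 f).symm
  rw [h3]
  simp only [← EE_sum]
  refine EE_mono fun l _ => ?_
  calc ∑ s ∈ Finset.Icc n N, ∑ k ∈ Finset.range (r + 1), ind (Fi s l) * f (pos l (s + k))
      ≤ ∑ s ∈ Finset.Icc n N, ind (Fi s l) * ∑ j ∈ Finset.Icc n (N + r), f (pos l j) := by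
        refine Finset.sum_le_sum fun s hs => ?_
        rw [Finset.mem_Icc] at hs
        rw [← Finset.mul_sum]
        refine mul_le_mul_of_nonneg_left ?_ (ind_nonneg _)
        have e : ∑ k ∈ Finset.range (r + 1), f (pos l (s + k)) =
            ∑ j ∈ Finset.Ico s (s + (r + 1)), f (pos l j) := by
          rw [Finset.sum_Ico_eq_sum_range]
          simp
        rw [e]
        refine Finset.sum_le_sum_of_subset_of_nonneg ?_ fun _ _ _ => hf _
        intro j hj
        simp only [Finset.mem_Ico, Finset.mem_Icc] at hj ⊢
        omega
    _ = (∑ s ∈ Finset.Icc n N, ind (Fi s l)) * ∑ j ∈ Finset.Icc n (N + r), f (pos l j) := by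
        rw [Finset.sum_mul]
    _ ≤ 1 * ∑ j ∈ Finset.Icc n (N + r), f (pos l j) := by
        refine mul_le_mul_of_nonneg_right ?_ (Finset.sum_nonneg fun _ _ => hf _)
        exact (sum_ind_le _ _ _ (hdis l) (fun _ _ _ => trivial)).trans (ind_le_one True)
    _ = _ := one_mul _

/-- Sum of heat kernels between two time windows. -/
def Sg (n N J : ℕ) : ℝ := ∑ s ∈ Finset.Icc n N, ∑ j ∈ Finset.range (J + 1), hk (s + j) 0

lemma Sg_le (n N J : ℕ) (hn : 0 < n) :
    Sg n N J ≤ 20000 * (1 + (Real.log (n + J : ℕ) - Real.log n)) := by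
  have h1 : Sg n N J ≤ 20000 * ∑ j ∈ Finset.range (J + 1), 1 / ((n + j : ℕ) : ℝ) := by
    rw [Sg, Finset.sum_comm, Finset.mul_sum]
    refine Finset.sum_le_sum fun j _ => ?_
    have := hk_sum_le' (a := n + j) (b := N + 1 + j) (by omega)
    rw [mul_one_div]
    refine le_trans (le_of_eq ?_) this
    rw [← Finset.sum_Ico_add' (fun k => hk k 0) n (N + 1) j]
    rfl
  have h2 : ∀ J : ℕ, ∑ j ∈ Finset.range (J + 1), 1 / ((n + j : ℕ) : ℝ) ≤
      1 + (Real.log (n + J : ℕ) - Real.log n) := by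
    intro J
    induction J with
    | zero =>
      have : (1 : ℝ) ≤ n := by exact_mod_cast hn
      simp
      exact inv_le_one_of_one_le₀ this
    | succ J ih =>
      rw [Finset.sum_range_succ]
      have hp : (0 : ℝ) < (n + J : ℕ) := by exact_mod_cast (by omega : 0 < n + J)
      have hp' : (0 : ℝ) < (n + (J + 1) : ℕ) := by exact_mod_cast (by omega : 0 < n + (J + 1))
      have := Real.one_sub_inv_le_log_of_pos (div_pos hp' hp)
      rw [Real.log_div hp'.ne' hp.ne', inv_div] at this
      have e : 1 - ((n + J : ℕ) : ℝ) / (n + (J + 1) : ℕ) = 1 / (n + (J + 1) : ℕ) := by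
        have : ((n + (J + 1) : ℕ) : ℝ) = (n + J : ℕ) + 1 := by push_cast; ring
        rw [this] at hp' ⊢
        field_simp
        ring
      linarith
  linarith [h2 J]

/-- Probability that a walk hits, after time `n`, the range of an independent walk. -/
def hh (n N M : ℕ) : ℝ :=
  EE M (fun v => EE N (fun w => ind (∃ s, n ≤ s ∧ s ≤ N ∧ ∃ i, i ≤ M ∧ pos w s = pos v i)))

lemma hk_meet {i M s : ℕ} (h : i ≤ M) :
    EE M (fun v => EE s (fun w => ind (pos v i = tot w))) = hk (s + i) 0 := by
  have : ∀ v, EE s (fun w => ind (pos v i = tot w)) = hk s (pos v i) := by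
    intro v
    exact EE_congr fun w _ => ind_congr eq_comm
  simp only [this]
  rw [EE_pos h, hk_ck, add_comm]

lemma pos_drop (v : List Step) (i j : ℕ) : pos (v.drop i) j = pos v (i + j) - pos v i := by
  have : v.take (i + j) = v.take i ++ (v.drop i).take j := List.take_add
  rw [pos, pos, pos, this, tot_append]
  abel

lemma hh_le (n N M r : ℕ) (θ : ℝ) (hθ : 0 < θ) :
    hh n N M ≤ Sg n (N + r) (M + r) * (1 / θ + EE r (fun l => ind (Gn r l < θ))) := by
  set p := EE r (fun l => ind (Gn r l < θ)) with hp
  have e0 : hh n N M = EE (M + r) (fun v => EE N (fun w =>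
      ind (∃ s, n ≤ s ∧ s ≤ N ∧ ∃ i, i ≤ M ∧ pos w s = pos v i))) := by
    rw [hh, ← EE_take (Nat.le_add_right M r)]
    refine EE_congr fun v _ => EE_congr fun w _ => ind_congr ?_
    refine exists_congr fun s => and_congr Iff.rfl (and_congr Iff.rfl
      (exists_congr fun i => and_congr_right fun hi => ?_))
    rw [pos_take hi]
  set good : List Step → Set (Zd 4) := fun v => {x | ∃ i, i ≤ M ∧ x = pos v i ∧ θ ≤ Gn r (v.drop i)}
  set f : List Step → Zd 4 → ℝ := fun v x => ∑ j ∈ Finset.range (M + r + 1), ind (pos v j = x) with hf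
  have e1 : hh n N M ≤ EE (M + r) (fun v => EE N (fun w => ind (∃ s, n ≤ s ∧ s ≤ N ∧ pos w s ∈ good v)))
      + EE (M + r) (fun v => EE N (fun w => ∑ s ∈ Finset.Icc n N, ∑ i ∈ Finset.range (M + 1),
          ind (pos v i = pos w s) * ind (Gn r (v.drop i) < θ))) := by
    rw [e0, ← EE_add]
    refine EE_mono fun v _ => ?_
    rw [← EE_add]
    refine EE_mono fun w _ => ?_
    refine le_trans (ind_or_le (q := ∃ s, n ≤ s ∧ s ≤ N ∧ pos w s ∈ good v)
      (r := ∃ s ∈ Finset.Icc n N, ∃ i ∈ Finset.range (M + 1), pos v i = pos w s ∧ Gn r (v.drop i) < θ) ?_) ?_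
    · rintro ⟨s, h1, h2, i, h3, h4⟩
      by_cases hg : θ ≤ Gn r (v.drop i)
      · exact Or.inl ⟨s, h1, h2, i, h3, h4, hg⟩
      · exact Or.inr ⟨s, Finset.mem_Icc.2 ⟨h1, h2⟩, i, Finset.mem_range.2 (by omega), h4.symm, not_le.1 hg⟩
    · gcongr
      refine (ind_exists_le _ _).trans (Finset.sum_le_sum fun s _ => ?_)
      refine (ind_exists_le _ _).trans (Finset.sum_le_sum fun i _ => ?_)
      rw [ind_and]
  have e2 : EE (M + r) (fun v => EE N (fun w => ind (∃ s, n ≤ s ∧ s ≤ N ∧ pos w s ∈ good v))) ≤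
      Sg n (N + r) (M + r) * (1 / θ) := by
    rw [mul_one_div, le_div_iff₀ hθ, mul_comm, ← EE_mul_left]
    have : Sg n (N + r) (M + r) =
        EE (M + r) (fun v => ∑ s ∈ Finset.Icc n (N + r), EE s (fun w => f v (tot w))) := by
      rw [EE_sum, Sg]
      refine Finset.sum_congr rfl fun s _ => ?_
      simp only [hf, EE_sum]
      refine Finset.sum_congr rfl fun j hj => ?_
      rw [Finset.mem_range] at hj
      exact (hk_meet (by omega)).symm
    rw [this]
    refine EE_mono fun v _ => ?_
    refine hit_lem n N r (f v) (fun x => Finset.sum_nonneg fun _ _ => ind_nonneg _) (good v) θ ?_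
    rintro x ⟨i, hi, rfl, hg⟩
    refine hg.trans ?_
    have : ∀ k, EE k (fun w => f v (pos v i + tot w)) =
        ∑ j ∈ Finset.range (M + r + 1), hk k (pos v j - pos v i) := by
      intro k
      simp only [hf, EE_sum]
      refine Finset.sum_congr rfl fun j _ => EE_congr fun w _ => ind_congr ?_
      rw [eq_sub_iff_add_eq, add_comm, eq_comm]
    simp only [this]
    rw [Finset.sum_comm]
    change _ ≤ ∑ j ∈ Finset.range (M + r + 1), gr r (pos v j - pos v i)
    calc Gn r (v.drop i) = ∑ j ∈ Finset.Ico i (i + (r + 1)), gr r (pos v j - pos v i) := by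
          rw [Finset.sum_Ico_eq_sum_range, Gn]
          simp [pos_drop]
      _ ≤ _ := by
          refine Finset.sum_le_sum_of_subset_of_nonneg ?_ fun _ _ _ => gr_nonneg _ _
          intro j hj
          simp only [Finset.mem_Ico, Finset.mem_range] at hj ⊢
          omega
  have e3 : EE (M + r) (fun v => EE N (fun w => ∑ s ∈ Finset.Icc n N, ∑ i ∈ Finset.range (M + 1),
          ind (pos v i = pos w s) * ind (Gn r (v.drop i) < θ))) ≤ Sg n (N + r) (M + r) * p := by
    have e4 : ∀ s ∈ Finset.Icc n N, ∀ i ∈ Finset.range (M + 1),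
        EE (M + r) (fun v => EE N (fun w => ind (pos v i = pos w s) * ind (Gn r (v.drop i) < θ))) =
        hk (s + i) 0 * p := by
      intro s hs i hi
      rw [Finset.mem_Icc] at hs
      rw [Finset.mem_range] at hi
      have a1 : ∀ v, EE N (fun w => ind (pos v i = pos w s) * ind (Gn r (v.drop i) < θ)) =
          EE s (fun w => ind (pos v i = tot w)) * ind (Gn r (v.drop i) < θ) := by
        intro v
        rw [EE_mul_right, EE_pos hs.2 (fun x => ind (pos v i = x))]
      simp only [a1]
      have a2 := EE_split (k := i) (m := r) (n := M + r) (by omega)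
        (fun v => EE s (fun w => ind (pos v i = tot w)) * ind (Gn r (v.drop i) < θ))
      have a3 : ∀ v : List Step, Gn r ((v.take (i + r)).drop i) = Gn r (v.drop i) := by
        intro v
        unfold Gn
        refine Finset.sum_congr rfl fun j hj => ?_
        rw [Finset.mem_range] at hj
        rw [pos_drop, pos_drop, pos_take (by omega), pos_take (by omega)]
      simp only [pos_take (Nat.le_add_right i r), a3] at a2
      rw [← a2, ← hk_meet (le_refl i), ← EE_mul_right]
      refine EE_congr fun u hu => ?_
      rw [hp, ← EE_mul_left]
      refine EE_congr fun v _ => ?_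
      rw [pos_append_left hu.ge, ← hu, List.drop_left]
    have e5 : EE (M + r) (fun v => EE N (fun w => ∑ s ∈ Finset.Icc n N, ∑ i ∈ Finset.range (M + 1),
          ind (pos v i = pos w s) * ind (Gn r (v.drop i) < θ))) =
        ∑ s ∈ Finset.Icc n N, ∑ i ∈ Finset.range (M + 1), hk (s + i) 0 * p := by
      simp only [EE_sum]
      exact Finset.sum_congr rfl fun s hs => Finset.sum_congr rfl fun i hi => e4 s hs i hi
    have hp0 : 0 ≤ p := EE_nonneg fun _ _ => ind_nonneg _
    rw [e5]
    simp only [← Finset.sum_mul]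
    gcongr
    unfold Sg
    calc _ ≤ ∑ s ∈ Finset.Icc n N, ∑ j ∈ Finset.range (M + r + 1), hk (s + j) 0 := by
          refine Finset.sum_le_sum fun s _ => ?_
          exact Finset.sum_le_sum_of_subset_of_nonneg (Finset.range_mono (by omega)) fun _ _ _ => hk_nonneg _ _
      _ ≤ _ := by
          refine Finset.sum_le_sum_of_subset_of_nonneg (Finset.Icc_subset_Icc le_rfl (by omega)) fun _ _ _ =>
            Finset.sum_nonneg fun _ _ => hk_nonneg _ _
  rw [mul_add]
  linarith


/-! ### The main finite inequality -/

/-- The finite-horizon event. -/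
def EvP (t t2 n N : ℕ) (b f w : ℕ → Zd 4) : Prop :=
  (∀ z, ((∃ s, s ≤ t ∧ b s = z) ∨ (∃ s, s ≤ t2 ∧ f s = z)) → ∀ s, 1 ≤ s → s ≤ n → w s ≠ z) ∧
  ∃ z, ((∃ s, s ≤ t ∧ b s = z) ∨ (∃ s, s ≤ t2 ∧ f s = z)) ∧ ∃ s, n ≤ s ∧ s ≤ N ∧ w s = z

/-- The probability of the finite-horizon event. -/
def Om (t t2 n N : ℕ) : ℝ :=
  EE t (fun b => EE t2 (fun f => EE N (fun w => ind (EvP t t2 n N (pos b) (pos f) (pos w)))))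

/-- Middle piece of the path. -/
def mid (H n : ℕ) (l : List Step) : Finset (Zd 4) := (Finset.Icc H (H + 3 * n)).image (pos l)

/-- Full range of the path. -/
def rng (M : ℕ) (l : List Step) : Set (Zd 4) := {x | ∃ j, j ≤ M ∧ x = pos l j}

lemma pos_rv_sub {u : List Step} {i k : ℕ} (hu : u.length = i) (hk' : k ≤ i) :
    pos (rv u) (i - k) = pos u k - tot u := by
  rw [pos_rv, hu, show i - (i - k) = k by omega]

lemma EE_two (i m : ℕ) (F : List Step → List Step → ℝ) {t t2 : ℕ} (ht : t ≤ i) (ht2 : t2 ≤ m) :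
    EE t (fun b => EE t2 (fun f => F b f)) =
      EE i (fun u => EE m (fun v => F ((rv u).take t) (v.take t2))) := by
  rw [EE_rv i (fun u => EE m (fun v => F (u.take t) (v.take t2))),
    EE_take ht (fun u => EE m (fun v => F u (v.take t2)))]
  exact EE_congr fun u _ => (EE_take ht2 (fun v => F u v)).symm

lemma Om_le_phi {t t2 n N H i : ℕ} (h1 : 2 * n ≤ t) (h2 : 2 * n ≤ t2) (h3 : t ≤ H) (h4 : t2 ≤ H)
    (hi1 : H + n ≤ i) (hi2 : i ≤ H + 2 * n) :
    Om t t2 n N ≤ EE (2 * H + 3 * n) (fun l =>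
      phi n N (mid H n l) (rng (2 * H + 3 * n) l) (pos l i)) := by
  obtain ⟨m, hm⟩ : ∃ m, 2 * H + 3 * n = i + m := ⟨2 * H + 3 * n - i, by omega⟩
  rw [Om, EE_two i m _ (by omega : t ≤ i) (by omega : t2 ≤ m)]
  conv_rhs => rw [hm, EE_append]
  refine EE_mono fun u hu => EE_mono fun v hv => ?_
  rw [phi]
  refine EE_mono fun w _ => ind_mono ?_
  have hx : pos (u ++ v) i = tot u := by rw [pos_append_left hu.ge, pos_length hu.le]
  rw [hx]
  have hback : ∀ j, j ≤ i → i - j ≤ t → pos ((rv u).take t) (i - j) = pos (u ++ v) j - tot u := by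
    intro j hj hjt
    rw [pos_take hjt, pos_rv_sub hu hj, pos_append_left (by omega)]
  have hfor : ∀ j, j ≤ t2 → pos (v.take t2) j = pos (u ++ v) (i + j) - tot u := by
    intro j hj
    rw [pos_take hj, pos_append_right' hu]; abel
  rintro ⟨ha, z, hz, s, hs1, hs2, rfl⟩
  constructor
  · intro s hs hsn hmem
    rw [mid, Finset.mem_image] at hmem
    obtain ⟨j, hj, hje⟩ := hmem
    rw [Finset.mem_Icc] at hj
    rcases le_total j i with hji | hji
    · refine ha (pos w s) (Or.inl ⟨i - j, by omega, ?_⟩) s hs hsn rfl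
      rw [hback j hji (by omega), hje]; abel
    · refine ha (pos w s) (Or.inr ⟨j - i, by omega, ?_⟩) s hs hsn rfl
      rw [hfor _ (by omega), show i + (j - i) = j by omega, hje]; abel
  · refine ⟨s, hs1, hs2, ?_⟩
    rcases hz with ⟨j, hj, he⟩ | ⟨j, hj, he⟩
    · refine ⟨i - j, by omega, ?_⟩
      have := hback (i - j) (by omega) (by omega)
      rw [show i - (i - j) = j by omega, he] at this
      rw [this]; abel
    · refine ⟨i + j, by omega, ?_⟩
      have := hfor j hj
      rw [he] at this
      rw [this]; abel

lemma hh_mono {n N j M : ℕ} (h : j ≤ M) :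
    EE j (fun v => EE N (fun w => ind (∃ s, n ≤ s ∧ s ≤ N ∧ ∃ i, i ≤ j ∧ pos w s = pos v i))) ≤
      hh n N M := by
  rw [hh, ← EE_take h]
  refine EE_mono fun v _ => EE_mono fun w _ => ind_mono ?_
  rintro ⟨s, h1, h2, i, hi, he⟩
  rw [pos_take hi] at he
  exact ⟨s, h1, h2, i, by omega, he⟩

lemma EE_psi_le {n N M j : ℕ} (hj : j ≤ M) :
    EE M (fun l => psi n N (rng M l) (pos l j)) ≤ 2 * hh n N M := by
  obtain ⟨m, hm⟩ : ∃ m, M = j + m := ⟨M - j, by omega⟩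
  have key : EE M (fun l => psi n N (rng M l) (pos l j)) ≤
      EE j (fun u => EE N (fun w => ind (∃ s, n ≤ s ∧ s ≤ N ∧ ∃ i, i ≤ j ∧ pos w s = pos (rv u) i))) +
      EE m (fun v => EE N (fun w => ind (∃ s, n ≤ s ∧ s ≤ N ∧ ∃ i, i ≤ m ∧ pos w s = pos v i))) := by
    conv_lhs => rw [hm, EE_append]
    have c : EE m (fun v => EE N (fun w => ind (∃ s, n ≤ s ∧ s ≤ N ∧ ∃ i, i ≤ m ∧ pos w s = pos v i)))
      = EE j (fun _ => EE m (fun v => EE N (fun w =>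
        ind (∃ s, n ≤ s ∧ s ≤ N ∧ ∃ i, i ≤ m ∧ pos w s = pos v i)))) := (EE_const _ _).symm
    rw [c, ← EE_add]
    refine EE_mono fun u hu => ?_
    rw [← EE_const m (EE N (fun w => ind (∃ s, n ≤ s ∧ s ≤ N ∧ ∃ i, i ≤ j ∧ pos w s = pos (rv u) i))),
      ← EE_add]
    refine EE_mono fun v hv => ?_
    rw [psi, ← EE_add]
    refine EE_mono fun w _ => ind_or_le ?_
    rintro ⟨s, h1, h2, i, hi, he⟩
    rw [pos_append_left hu.ge, pos_length hu.le] at he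
    rcases le_total i j with hij | hij
    · refine Or.inl ⟨s, h1, h2, j - i, by omega, ?_⟩
      rw [pos_rv_sub hu hij]
      rw [pos_append_left (by omega)] at he
      rw [← he]; abel
    · refine Or.inr ⟨s, h1, h2, i - j, by omega, ?_⟩
      have := pos_append_right' hu (v := v) (i - j)
      rw [show j + (i - j) = i by omega, ← he] at this
      exact add_left_cancel this
  rw [EE_rv j (fun u => EE N (fun w => ind (∃ s, n ≤ s ∧ s ≤ N ∧ ∃ i, i ≤ j ∧ pos w s = pos u i)))] at key
  have k1 := hh_mono (n := n) (N := N) hj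
  have k2 := hh_mono (n := n) (N := N) (by omega : m ≤ M)
  linarith

/-- Local time of the middle piece. -/
def loc (H n : ℕ) (l : List Step) (x : Zd 4) : ℕ :=
  ((Finset.Icc H (H + 3 * n)).filter (fun j => pos l j = x)).card

/-- Green's function of the middle piece. -/
def Gm (H n : ℕ) (l : List Step) (x : Zd 4) : ℝ :=
  ∑ j ∈ Finset.Icc H (H + 3 * n), gr n (x - pos l j)

lemma Gm_nonneg (H n : ℕ) (l : List Step) (x : Zd 4) : 0 ≤ Gm H n l x :=
  Finset.sum_nonneg fun _ _ => gr_nonneg _ _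

lemma sum_phi_le (H n N : ℕ) (hnN : n ≤ N) (l : List Step) (B : Set (Zd 4)) :
    ∑ i ∈ Finset.Icc H (H + 3 * n),
      phi n N (mid H n l) B (pos l i) * Gm H n l (pos l i) / loc H n l (pos l i) ≤
    ∑ j ∈ Finset.Icc H (H + 3 * n), psi n (N + n) B (pos l j) := by
  have h1 := Finset.sum_comp (s := Finset.Icc H (H + 3 * n))
    (fun x => phi n N (mid H n l) B x * Gm H n l x / (loc H n l x : ℝ)) (pos l)
  rw [h1]
  have h2 : ∀ x ∈ mid H n l, loc H n l x • (phi n N (mid H n l) B x * Gm H n l x / (loc H n l x : ℝ)) =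
      ∑ j ∈ Finset.Icc H (H + 3 * n), gr n (x - pos l j) * phi n N (mid H n l) B x := by
    intro x hx
    have : 0 < loc H n l x := by
      rw [mid, Finset.mem_image] at hx
      obtain ⟨j, hj, he⟩ := hx
      exact Finset.card_pos.2 ⟨j, Finset.mem_filter.2 ⟨hj, he⟩⟩
    have h0 : (loc H n l x : ℝ) ≠ 0 := by positivity
    rw [nsmul_eq_mul, mul_div_cancel₀ _ h0, Gm, ← Finset.sum_mul, mul_comm]
  have h3 := Finset.sum_congr rfl h2
  rw [Finset.sum_comm] at h3
  refine le_trans (le_of_eq ?_) (h3.le.trans (Finset.sum_le_sum fun j _ => last_exit n N hnN _ B _))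
  refine Finset.sum_congr rfl fun x _ => ?_
  simp only [loc]

/-- The bad event at time `i`. -/
def Bad (H n : ℕ) (K θ : ℝ) (l : List Step) (i : ℕ) : Prop :=
  K < loc H n l (pos l i) ∨ Gm H n l (pos l i) < θ

lemma Vis_eq (n : ℕ) (l : List Step) :
    Vis n l = ((Finset.range n).filter (fun j => pos l (j + 1) = 0)).card := by
  rw [Vis, Finset.card_filter]

lemma EE_bad {H n i : ℕ} {K θ p : ℝ} (hH : 2 * n ≤ H) (hi1 : H + n ≤ i) (hi2 : i ≤ H + 2 * n)
    (hK : 0 < K) (hp : EE n (fun l => ind (Gn n l < θ)) = p) :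
    EE (2 * H + 3 * n) (fun l => ind (Bad H n (2 * K + 9) θ l i)) ≤
      2 * (120 * 20000 ^ 5 / K ^ 5) + p ^ 2 := by
  obtain ⟨m, hm⟩ : ∃ m, 2 * H + 3 * n = i + m := ⟨2 * H + 3 * n - i, by omega⟩
  have key : EE (2 * H + 3 * n) (fun l => ind (Bad H n (2 * K + 9) θ l i)) ≤
      EE i (fun u => EE m (fun v => ind (K + 4 ≤ (Vis (2 * n) (rv u) : ℝ)) +
        ind (K + 4 ≤ (Vis (2 * n) v : ℝ)) + ind (Gn n (rv u) < θ) * ind (Gn n v < θ))) := by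
    rw [hm, EE_append]
    refine EE_mono fun u hu => EE_mono fun v hv => ?_
    rw [← ind_and]
    refine le_trans (ind_or_le (q := K + 4 ≤ (Vis (2 * n) (rv u) : ℝ) ∨ K + 4 ≤ (Vis (2 * n) v : ℝ))
      (r := Gn n (rv u) < θ ∧ Gn n v < θ) ?_) ?_
    swap
    · gcongr
      exact ind_or_le id
    have hx : pos (u ++ v) i = tot u := by rw [pos_append_left hu.ge, pos_length hu.le]
    have hback : ∀ k, k ≤ i → pos (rv u) k = pos (u ++ v) (i - k) - tot u := by
      intro k hk'
      rw [pos_rv, hu, pos_append_left (by omega)]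
    have hfor : ∀ k, pos v k = pos (u ++ v) (i + k) - tot u := by
      intro k
      rw [pos_append_right' hu]; abel
    rintro (hb | hb)
    · left
      by_contra hcon
      push Not at hcon
      rw [hx] at hb
      have hsub : (Finset.Icc H (H + 3 * n)).filter (fun j => pos (u ++ v) j = tot u) ⊆
          {i} ∪ (((Finset.range (2 * n)).filter (fun j => pos (rv u) (j + 1) = 0)).image (fun k => i - (k + 1)) ∪
            ((Finset.range (2 * n)).filter (fun j => pos v (j + 1) = 0)).image (fun k => i + (k + 1))) := by
        intro j hj
        rw [Finset.mem_filter, Finset.mem_Icc] at hj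
        simp only [Finset.mem_union, Finset.mem_singleton, Finset.mem_image, Finset.mem_filter,
          Finset.mem_range]
        rcases lt_trichotomy j i with h | h | h
        · refine Or.inr (Or.inl ⟨i - j - 1, ⟨by omega, ?_⟩, by omega⟩)
          rw [hback _ (by omega), show i - (i - j - 1 + 1) = j by omega, hj.2, sub_self]
        · exact Or.inl h
        · refine Or.inr (Or.inr ⟨j - i - 1, ⟨by omega, ?_⟩, by omega⟩)
          rw [hfor, show i + (j - i - 1 + 1) = j by omega, hj.2, sub_self]
      have hcard := (Finset.card_le_card hsub).trans ((Finset.card_union_le _ _).trans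
        (Nat.add_le_add_left ((Finset.card_union_le _ _).trans
          (Nat.add_le_add Finset.card_image_le Finset.card_image_le)) _))
      rw [← Vis_eq, ← Vis_eq, Finset.card_singleton] at hcard
      have : (loc H n (u ++ v) (tot u) : ℝ) ≤ 1 + (Vis (2 * n) (rv u) + Vis (2 * n) v) := by
        exact_mod_cast hcard
      linarith
    · right
      rw [hx] at hb
      constructor
      · refine lt_of_le_of_lt ?_ hb
        have : Gn n (rv u) = ∑ j ∈ (Finset.range (n + 1)).image (fun k => i - k),
            gr n (tot u - pos (u ++ v) j) := by
          rw [Finset.sum_image]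
          · refine Finset.sum_congr rfl fun k hk' => ?_
            rw [Finset.mem_range] at hk'
            rw [hback k (by omega), ← gr_neg, neg_sub]
          · intro a ha b hb hab
            simp only [Finset.coe_range, Set.mem_Iio] at ha hb
            simp only at hab
            omega
        rw [this]
        refine Finset.sum_le_sum_of_subset_of_nonneg ?_ fun _ _ _ => gr_nonneg _ _
        intro j hj
        simp only [Finset.mem_image, Finset.mem_range] at hj
        obtain ⟨k, hk1, hk2⟩ := hj
        rw [Finset.mem_Icc]
        omega
      · refine lt_of_le_of_lt ?_ hb
        have : Gn n v = ∑ j ∈ (Finset.range (n + 1)).image (fun k => i + k),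
            gr n (tot u - pos (u ++ v) j) := by
          rw [Finset.sum_image]
          · refine Finset.sum_congr rfl fun k hk' => ?_
            rw [hfor k, ← gr_neg, neg_sub]
          · intro a ha b hb hab
            simp only at hab
            omega
        rw [this]
        refine Finset.sum_le_sum_of_subset_of_nonneg ?_ fun _ _ _ => gr_nonneg _ _
        intro j hj
        simp only [Finset.mem_image, Finset.mem_range] at hj
        obtain ⟨k, hk1, hk2⟩ := hj
        rw [Finset.mem_Icc]
        omega
  refine key.trans ?_
  simp only [EE_add, EE_const, EE_mul_left, EE_mul_right]
  have hext : ∀ r, n ≤ r → EE r (fun l => ind (Gn n l < θ)) = p := by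
    intro r hr
    rw [← hp, ← EE_take hr]
    refine EE_congr fun l _ => ?_
    have : Gn n l = Gn n (l.take n) := by
      unfold Gn
      refine Finset.sum_congr rfl fun j hj => ?_
      rw [pos_take (by rw [Finset.mem_range] at hj; omega)]
    rw [this]
  rw [EE_rv i (fun u => ind (K + 4 ≤ (Vis (2 * n) u : ℝ))), EE_rv i (fun u => ind (Gn n u < θ)),
    hext i (by omega), hext m (by omega)]
  have t1 := Vis_tail (N := 2 * n) (r := i) (by omega) hK
  have t2 := Vis_tail (N := 2 * n) (r := m) (by omega) hK
  rw [sq]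
  linarith

lemma Om_le {t t2 n N H : ℕ} {K θ p : ℝ} (h1 : 2 * n ≤ t) (h2 : 2 * n ≤ t2) (h3 : t ≤ H) (h4 : t2 ≤ H)
    (hnN : n ≤ N) (hK : 0 < K) (hθ : 0 < θ) (hp : EE n (fun l => ind (Gn n l < θ)) = p) :
    Om t t2 n N ≤ 2 * (120 * 20000 ^ 5 / K ^ 5) + p ^ 2 +
      6 * ((2 * K + 9) / θ) * hh n (N + n) (2 * H + 3 * n) := by
  set M := 2 * H + 3 * n with hM
  set Q := 2 * (120 * 20000 ^ 5 / K ^ 5) + p ^ 2 with hQ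
  set I := Finset.Icc (H + n) (H + 2 * n) with hI
  set J := Finset.Icc H (H + 3 * n) with hJ
  have hIJ : I ⊆ J := Finset.Icc_subset_Icc (by omega) (by omega)
  have hcardI : (I.card : ℝ) = n + 1 := by
    rw [hI, Nat.card_Icc, show H + 2 * n + 1 - (H + n) = n + 1 by omega]; push_cast; rfl
  have hcardJ : (J.card : ℝ) = 3 * n + 1 := by
    rw [hJ, Nat.card_Icc, show H + 3 * n + 1 - H = 3 * n + 1 by omega]; push_cast; rfl
  set P : List Step → ℕ → ℝ := fun l i => phi n N (mid H n l) (rng M l) (pos l i) with hP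
  have pw : ∀ l, ∑ i ∈ I, P l i ≤ ∑ i ∈ I, ind (Bad H n (2 * K + 9) θ l i) +
      ((2 * K + 9) / θ) * ∑ j ∈ J, psi n (N + n) (rng M l) (pos l j) := by
    intro l
    have a1 : ∀ i ∈ I, P l i ≤ ind (Bad H n (2 * K + 9) θ l i) +
        ((2 * K + 9) / θ) * (P l i * Gm H n l (pos l i) / loc H n l (pos l i)) := by
      intro i hi
      have hP0 : 0 ≤ P l i := phi_nonneg _ _ _ _ _
      have hP1 : P l i ≤ 1 := phi_le_one _ _ _ _ _
      have hG0 := Gm_nonneg H n l (pos l i)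
      by_cases hb : Bad H n (2 * K + 9) θ l i
      · rw [ind_true hb]
        have : 0 ≤ ((2 * K + 9) / θ) * (P l i * Gm H n l (pos l i) / loc H n l (pos l i)) := by positivity
        linarith
      · rw [ind_false hb, zero_add]
        simp only [Bad, not_or, not_lt] at hb
        have hl : (0 : ℝ) < loc H n l (pos l i) := by
          have : 0 < loc H n l (pos l i) :=
            Finset.card_pos.2 ⟨i, Finset.mem_filter.2 ⟨hIJ hi, rfl⟩⟩
          exact_mod_cast this
        rw [div_mul_div_comm, le_div_iff₀ (by positivity)]
        have b1 : θ * loc H n l (pos l i) ≤ Gm H n l (pos l i) * (2 * K + 9) :=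
          mul_le_mul hb.2 hb.1 hl.le hG0
        calc P l i * (θ * loc H n l (pos l i)) ≤ P l i * (Gm H n l (pos l i) * (2 * K + 9)) := by gcongr
          _ = _ := by ring
    refine (Finset.sum_le_sum a1).trans ?_
    rw [Finset.sum_add_distrib, ← Finset.mul_sum]
    gcongr
    refine le_trans ?_ (sum_phi_le H n N hnN l (rng M l))
    refine Finset.sum_le_sum_of_subset_of_nonneg hIJ fun i _ _ => ?_
    have hP0 : 0 ≤ P l i := phi_nonneg _ _ _ _ _
    have hG0 := Gm_nonneg H n l (pos l i)
    positivity
  have tot1 : ((n : ℝ) + 1) * Om t t2 n N ≤ EE M (fun l => ∑ i ∈ I, P l i) := by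
    rw [EE_sum, ← hcardI, ← nsmul_eq_mul, ← Finset.sum_const]
    refine Finset.sum_le_sum fun i hi => ?_
    rw [hI, Finset.mem_Icc] at hi
    exact Om_le_phi h1 h2 h3 h4 hi.1 hi.2
  have tot2 := tot1.trans (EE_mono fun l _ => pw l)
  rw [EE_add, EE_mul_left, EE_sum, EE_sum] at tot2
  have tot3 : ∑ i ∈ I, EE M (fun l => ind (Bad H n (2 * K + 9) θ l i)) ≤ ((n : ℝ) + 1) * Q := by
    rw [← hcardI, ← nsmul_eq_mul, ← Finset.sum_const]
    refine Finset.sum_le_sum fun i hi => ?_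
    rw [hI, Finset.mem_Icc] at hi
    exact EE_bad (by omega) hi.1 hi.2 hK hp
  have hhh : 0 ≤ hh n (N + n) M := EE_nonneg fun _ _ => EE_nonneg fun _ _ => ind_nonneg _
  have tot4 : ∑ j ∈ J, EE M (fun l => psi n (N + n) (rng M l) (pos l j)) ≤
      ((n : ℝ) + 1) * (6 * hh n (N + n) M) := by
    calc _ ≤ ∑ j ∈ J, 2 * hh n (N + n) M := by
          refine Finset.sum_le_sum fun j hj => ?_
          rw [hJ, Finset.mem_Icc] at hj
          exact EE_psi_le (by omega)
      _ = (3 * n + 1) * (2 * hh n (N + n) M) := by rw [Finset.sum_const, nsmul_eq_mul, hcardJ]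
      _ ≤ _ := by nlinarith
  have hKt : 0 ≤ (2 * K + 9) / θ := by positivity
  have tot5 := mul_le_mul_of_nonneg_left tot4 hKt
  have hn1 : (0 : ℝ) < n + 1 := by positivity
  refine le_of_mul_le_mul_left ?_ hn1
  calc _ ≤ _ := tot2
    _ ≤ ((n : ℝ) + 1) * Q + (2 * K + 9) / θ * (((n : ℝ) + 1) * (6 * hh n (N + n) M)) := add_le_add tot3 tot5
    _ = _ := by ring


/-! ### Link with the measures -/

lemma EE_eq_sum (n : ℕ) (F : List Step → ℝ) :
    EE n F = ∑ f : Fin n → Step, (1 / 8 : ℝ) ^ n * F (List.ofFn f) := by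
  induction n generalizing F with
  | zero => simp [EE_zero]
  | succ n ih =>
    rw [EE_succ]
    simp only [ih]
    have h := (Fin.consEquiv (fun _ : Fin (n + 1) => Step)).sum_comp
      (fun f => (1 / 8 : ℝ) ^ (n + 1) * F (List.ofFn f))
    rw [Fintype.sum_prod_type] at h
    rw [← h, Finset.mul_sum]
    refine Fintype.sum_congr _ _ fun s => ?_
    rw [Finset.mul_sum]
    refine Fintype.sum_congr _ _ fun f => ?_
    have h2 : List.ofFn ((Fin.consEquiv (fun _ : Fin (n + 1) => Step)) (s, f)) = s :: List.ofFn f := by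
      simp only [Fin.consEquiv, Equiv.coe_fn_mk, List.ofFn_cons]
    rw [h2]
    ring

lemma exists_step {x y : Zd 4} (h : IsNN x y) : ∃ s : Step, y = x + vec s := by
  unfold IsNN at h
  have key : ∀ (i : Fin 4) (b : Bool), (∀ j, y j = x j + (if j = i then (if b then 1 else -1) else 0)) →
      ∃ s : Step, y = x + vec s := by
    intro i b hb
    refine ⟨(i, b), funext fun j => ?_⟩
    rw [hb j, Pi.add_apply, vec, Pi.single_apply]
  obtain ⟨i, hi, hj⟩ : ∃ i : Fin 4, (x i - y i).natAbs = 1 ∧ ∀ j, j ≠ i → (x j - y j).natAbs = 0 := by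
    suffices hs : ∀ a : Fin 4 → ℕ, (∑ k, a k) = 1 → ∃ i : Fin 4, a i = 1 ∧ ∀ j, j ≠ i → a j = 0 from
      hs (fun k => (x k - y k).natAbs) h
    clear h key
    intro a h
    rw [Fin.sum_univ_four] at h
    have hc : (a 0 = 1 ∧ a 1 = 0 ∧ a 2 = 0 ∧ a 3 = 0) ∨ (a 0 = 0 ∧ a 1 = 1 ∧ a 2 = 0 ∧ a 3 = 0) ∨
      (a 0 = 0 ∧ a 1 = 0 ∧ a 2 = 1 ∧ a 3 = 0) ∨ (a 0 = 0 ∧ a 1 = 0 ∧ a 2 = 0 ∧ a 3 = 1) := by omega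
    rcases hc with h | h | h | h
    · exact ⟨0, h.1, fun j hj => by fin_cases j <;> simp_all⟩
    · exact ⟨1, h.2.1, fun j hj => by fin_cases j <;> simp_all⟩
    · exact ⟨2, h.2.2.1, fun j hj => by fin_cases j <;> simp_all⟩
    · exact ⟨3, h.2.2.2, fun j hj => by fin_cases j <;> simp_all⟩
  have hj' : ∀ j, j ≠ i → y j = x j := by
    intro j hne
    have := Int.natAbs_eq_zero.1 (hj j hne)
    omega
  rcases Int.natAbs_eq (x i - y i) with h1 | h1
  · refine key i false fun j => ?_
    by_cases hji : j = i
    · subst hji; rw [hi] at h1; simp; omega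
    · simp [hji, hj' j hji]
  · refine key i true fun j => ?_
    by_cases hji : j = i
    · subst hji; rw [hi] at h1; simp; omega
    · simp [hji, hj' j hji]

/-- A cylinder of paths. -/
def Cyl (N : ℕ) (w : ℕ → Zd 4) : Set (ℕ → Zd 4) := {ω | ∀ t ≤ N, ω t = w t}

/-- A nearest neighbour path from the origin. -/
def NNP (N : ℕ) (w : ℕ → Zd 4) : Prop := w 0 = 0 ∧ ∀ t < N, IsNN (w t) (w (t + 1))

/-- Extend a finite path. -/
def extP (N : ℕ) (w : Fin (N + 1) → Zd 4) (t : ℕ) : Zd 4 := if h : t < N + 1 then w ⟨t, h⟩ else 0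

/-- The null set of paths that are not nearest neighbour paths. -/
def Nul (N : ℕ) : Set (ℕ → Zd 4) :=
  ⋃ w : {w : Fin (N + 1) → Zd 4 // ¬ NNP N (extP N w)}, Cyl N (extP N w.1)

lemma measurableSet_Cyl (N : ℕ) (w : ℕ → Zd 4) : MeasurableSet (Cyl N w) := by
  have : Cyl N w = ⋂ t, ⋂ (_ : t ≤ N), (fun ω : ℕ → Zd 4 => ω t) ⁻¹' {w t} := by
    ext ω; simp [Cyl]
  rw [this]
  exact MeasurableSet.iInter fun t => MeasurableSet.iInter fun _ =>
    measurable_pi_apply t (measurableSet_singleton _)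

lemma measurableSet_Nul (N : ℕ) : MeasurableSet (Nul N) :=
  MeasurableSet.iUnion fun _ => measurableSet_Cyl _ _

lemma Nul_null {P : Measure (ℕ → Zd 4)} (hP : IsSRW 4 0 P) (N : ℕ) : P (Nul N) = 0 := by
  refine measure_iUnion_null fun w => ?_
  have := hP.2 N (extP N w.1)
  rw [Cyl, this]
  exact if_neg w.2

lemma Cyl_le {P : Measure (ℕ → Zd 4)} (hP : IsSRW 4 0 P) (N : ℕ) (w : ℕ → Zd 4) :
    P (Cyl N w) ≤ ENNReal.ofReal ((1 / 8 : ℝ) ^ N) := by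
  rw [Cyl, hP.2 N w]
  split_ifs
  · rw [ENNReal.ofReal_pow (by norm_num), one_div, ENNReal.ofReal_inv_of_pos (by norm_num)]
    norm_num
  · exact bot_le

lemma mem_Nul_or (N : ℕ) (ω : ℕ → Zd 4) :
    ω ∈ Nul N ∨ ∃ f : Fin N → Step, ω ∈ Cyl N (pos (List.ofFn f)) := by
  by_cases h : NNP N ω
  · right
    have key : ∀ k, k ≤ N → ∃ l : List Step, l.length = k ∧ ∀ t ≤ k, ω t = pos l t := by
      intro k
      induction k with
      | zero =>
        intro _
        refine ⟨[], rfl, fun t ht => ?_⟩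
        rw [Nat.le_zero.1 ht, h.1, pos_zero]
      | succ k ih =>
        intro hk'
        obtain ⟨l, hl, hp⟩ := ih (by omega)
        obtain ⟨s, hs⟩ := exists_step (h.2 k (by omega))
        refine ⟨l ++ [s], by simp [hl], fun t ht => ?_⟩
        rcases Nat.lt_or_ge t (k + 1) with h1 | h1
        · rw [pos_append_left (by omega), hp t (by omega)]
        · have : t = k + 1 := by omega
          rw [this, pos_length (by simp [hl]), hs, hp k le_rfl, pos_length hl.le, tot_append]
          simp
    obtain ⟨l, hl, hp⟩ := key N le_rfl
    subst hl
    refine ⟨l.get, ?_⟩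
    rw [List.ofFn_get]
    exact hp
  · left
    have e : ∀ t ≤ N, ω t = extP N (fun i => ω i) t := by
      intro t ht
      simp [extP, Nat.lt_succ_of_le ht]
    refine Set.mem_iUnion.2 ⟨⟨fun i => ω i, fun hn => h ?_⟩, e⟩
    refine ⟨(e 0 (by omega)).trans hn.1, fun t ht => ?_⟩
    rw [e t (by omega), e (t + 1) (by omega)]
    exact hn.2 t ht

lemma EvP_congr {t t2 n N : ℕ} (hn : n ≤ N) {b f w b' f' w' : ℕ → Zd 4}
    (hb : ∀ s ≤ t, b s = b' s) (hf : ∀ s ≤ t2, f s = f' s) (hw : ∀ s ≤ N, w s = w' s)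
    (h : EvP t t2 n N b f w) : EvP t t2 n N b' f' w' := by
  have hz : ∀ z, ((∃ s, s ≤ t ∧ b s = z) ∨ (∃ s, s ≤ t2 ∧ f s = z)) ↔
      ((∃ s, s ≤ t ∧ b' s = z) ∨ (∃ s, s ≤ t2 ∧ f' s = z)) := by
    intro z
    refine or_congr (exists_congr fun s => and_congr_right fun hs => by rw [hb s hs])
      (exists_congr fun s => and_congr_right fun hs => by rw [hf s hs])
  obtain ⟨h1, z, h2, s, h3, h4, h5⟩ := h
  refine ⟨fun z hz' s hs1 hs2 => ?_, z, (hz z).1 h2, s, h3, h4, by rw [← hw s h4, h5]⟩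
  rw [← hw s (by omega)]
  exact h1 z ((hz z).2 hz') s hs1 hs2

lemma Q_le_Om {P : Measure (ℕ → Zd 4)} (hP : IsSRW 4 0 P)
    (Q : Measure (((ℕ → Zd 4) × (ℕ → Zd 4)) × (ℕ → Zd 4)))
    (hQ : ∀ (A B E : Set (ℕ → Zd 4)), MeasurableSet A → MeasurableSet B →
          MeasurableSet E → Q ((A ×ˢ B) ×ˢ E) = P A * P B * P E)
    {t t2 n N : ℕ} (hn : n ≤ N) :
    Q {q | EvP t t2 n N q.1.2 q.1.1 q.2} ≤ ENNReal.ofReal (Om t t2 n N) := by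
  set Z : Set (((ℕ → Zd 4) × (ℕ → Zd 4)) × (ℕ → Zd 4)) :=
    (((Nul t2) ×ˢ Set.univ) ×ˢ Set.univ) ∪ (((Set.univ ×ˢ (Nul t)) ×ˢ Set.univ) ∪
      ((Set.univ ×ˢ Set.univ) ×ˢ (Nul N))) with hZ
  have hZ0 : Q Z = 0 := by
    refine measure_union_null ?_ (measure_union_null ?_ ?_)
    · rw [hQ _ _ _ (measurableSet_Nul _) MeasurableSet.univ MeasurableSet.univ, Nul_null hP]; simp
    · rw [hQ _ _ _ MeasurableSet.univ (measurableSet_Nul _) MeasurableSet.univ, Nul_null hP]; simp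
    · rw [hQ _ _ _ MeasurableSet.univ MeasurableSet.univ (measurableSet_Nul _), Nul_null hP]; simp
  set S : (Fin t → Step) × (Fin t2 → Step) × (Fin N → Step) →
      Set (((ℕ → Zd 4) × (ℕ → Zd 4)) × (ℕ → Zd 4)) := fun i =>
    {q | EvP t t2 n N (pos (List.ofFn i.1)) (pos (List.ofFn i.2.1)) (pos (List.ofFn i.2.2)) ∧
      q ∈ ((Cyl t2 (pos (List.ofFn i.2.1))) ×ˢ (Cyl t (pos (List.ofFn i.1)))) ×ˢ
        (Cyl N (pos (List.ofFn i.2.2)))} with hS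
  have hsub : {q : ((ℕ → Zd 4) × (ℕ → Zd 4)) × (ℕ → Zd 4) | EvP t t2 n N q.1.2 q.1.1 q.2} ⊆
      Z ∪ ⋃ i, S i := by
    rintro ⟨⟨f, b⟩, w⟩ hq
    simp only [Set.mem_setOf_eq] at hq
    rcases mem_Nul_or t2 f with h1 | ⟨f', h1⟩
    · exact Or.inl (Or.inl ⟨⟨h1, trivial⟩, trivial⟩)
    rcases mem_Nul_or t b with h2 | ⟨b', h2⟩
    · exact Or.inl (Or.inr (Or.inl ⟨⟨trivial, h2⟩, trivial⟩))
    rcases mem_Nul_or N w with h3 | ⟨w', h3⟩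
    · exact Or.inl (Or.inr (Or.inr ⟨⟨trivial, trivial⟩, h3⟩))
    refine Or.inr (Set.mem_iUnion.2 ⟨(b', f', w'), ?_, ⟨⟨h1, h2⟩, h3⟩⟩)
    exact EvP_congr hn h2 h1 h3 hq
  have hSi : ∀ i, Q (S i) ≤ ENNReal.ofReal ((1 / 8 : ℝ) ^ t * ((1 / 8 : ℝ) ^ t2 * ((1 / 8 : ℝ) ^ N *
      ind (EvP t t2 n N (pos (List.ofFn i.1)) (pos (List.ofFn i.2.1)) (pos (List.ofFn i.2.2)))))) := by
    intro i
    by_cases h : EvP t t2 n N (pos (List.ofFn i.1)) (pos (List.ofFn i.2.1)) (pos (List.ofFn i.2.2))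
    · rw [ind_true h, mul_one]
      refine (measure_mono (fun q hq => hq.2)).trans ?_
      rw [hQ _ _ _ (measurableSet_Cyl _ _) (measurableSet_Cyl _ _) (measurableSet_Cyl _ _),
        ENNReal.ofReal_mul (by positivity), ENNReal.ofReal_mul (by positivity), ← mul_assoc,
        mul_comm (ENNReal.ofReal ((1 / 8 : ℝ) ^ t))]
      gcongr <;> exact Cyl_le hP _ _
    · have : S i = ∅ := by
        ext q; simp only [hS, Set.mem_setOf_eq, Set.mem_empty_iff_false, iff_false]
        exact fun hq => h hq.1
      rw [this]; simp
  calc Q _ ≤ Q (Z ∪ ⋃ i, S i) := measure_mono hsub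
    _ ≤ Q Z + Q (⋃ i, S i) := measure_union_le _ _
    _ = Q (⋃ i, S i) := by rw [hZ0, zero_add]
    _ ≤ ∑ i, Q (S i) := measure_iUnion_fintype_le _ _
    _ ≤ ∑ i : (Fin t → Step) × (Fin t2 → Step) × (Fin N → Step), ENNReal.ofReal
        ((1 / 8 : ℝ) ^ t * ((1 / 8 : ℝ) ^ t2 * ((1 / 8 : ℝ) ^ N *
      ind (EvP t t2 n N (pos (List.ofFn i.1)) (pos (List.ofFn i.2.1)) (pos (List.ofFn i.2.2)))))) :=
        Finset.sum_le_sum fun i _ => hSi i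
    _ = ENNReal.ofReal (Om t t2 n N) := by
        rw [← ENNReal.ofReal_sum_of_nonneg]
        · congr 1
          rw [Om]
          simp only [EE_eq_sum, Fintype.sum_prod_type, Finset.mul_sum]
        · intro i _
          have := ind_nonneg (EvP t t2 n N (pos (List.ofFn i.1)) (pos (List.ofFn i.2.1)) (pos (List.ofFn i.2.2)))
          positivity

lemma Q_event_le {P : Measure (ℕ → Zd 4)} (hP : IsSRW 4 0 P)
    (Q : Measure (((ℕ → Zd 4) × (ℕ → Zd 4)) × (ℕ → Zd 4)))
    (hQ : ∀ (A B E : Set (ℕ → Zd 4)), MeasurableSet A → MeasurableSet B →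
          MeasurableSet E → Q ((A ×ˢ B) ×ˢ E) = P A * P B * P E)
    {t t2 n : ℕ} {β : ℝ} (hβ0 : 0 ≤ β) (hβ : ∀ N, n ≤ N → Om t t2 n N ≤ β) :
    (Q {q | (∀ z : Zd 4,
              ((∃ s ≤ t, q.1.2 s = z) ∨ (∃ s ≤ t2, q.1.1 s = z)) →
                ∀ s : ℕ, 1 ≤ s → s ≤ n → q.2 s ≠ z) ∧
            ∃ z : Zd 4,
              ((∃ s ≤ t, q.1.2 s = z) ∨ (∃ s ≤ t2, q.1.1 s = z)) ∧
                ∃ s : ℕ, n ≤ s ∧ q.2 s = z}).toReal ≤ β := by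
  refine ENNReal.toReal_le_of_le_ofReal hβ0 ?_
  set E : ℕ → Set (((ℕ → Zd 4) × (ℕ → Zd 4)) × (ℕ → Zd 4)) := fun N =>
    {q | EvP t t2 n N q.1.2 q.1.1 q.2} with hE
  have hmono : Monotone E := by
    intro N N' hNN q hq
    obtain ⟨h1, z, h2, s, h3, h4, h5⟩ := hq
    exact ⟨h1, z, h2, s, h3, h4.trans hNN, h5⟩
  have hsub : {q : ((ℕ → Zd 4) × (ℕ → Zd 4)) × (ℕ → Zd 4) | (∀ z : Zd 4,
              ((∃ s ≤ t, q.1.2 s = z) ∨ (∃ s ≤ t2, q.1.1 s = z)) →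
                ∀ s : ℕ, 1 ≤ s → s ≤ n → q.2 s ≠ z) ∧
            ∃ z : Zd 4,
              ((∃ s ≤ t, q.1.2 s = z) ∨ (∃ s ≤ t2, q.1.1 s = z)) ∧
                ∃ s : ℕ, n ≤ s ∧ q.2 s = z} ⊆ ⋃ N, E N := by
    rintro q ⟨h1, z, h2, s, h3, h4⟩
    exact Set.mem_iUnion.2 ⟨s, h1, z, h2, s, h3, le_rfl, h4⟩
  refine (measure_mono hsub).trans ?_
  rw [hmono.measure_iUnion]
  refine iSup_le fun N => ?_
  refine (measure_mono (hmono (le_max_left N n))).trans ?_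
  refine (Q_le_Om hP Q hQ (le_max_right N n)).trans ?_
  exact ENNReal.ofReal_le_ofReal (hβ _ (le_max_right N n))


/-! ### Final asymptotics -/

lemma final_arith {c C0 M b θ p h S K X L : ℝ} (hc : 0 < c) (hC0 : 0 < C0) (hM : 1 ≤ M)
    (hL : L = M ^ 10) (hK : K = M ^ 3) (hb : L / 2 ≤ b) (hθ : θ = c * b) (hp0 : 0 ≤ p)
    (hp : p ≤ C0 / b) (hS : S ≤ 20000 * (115 * M)) (hh : h ≤ S * (1 / θ + p))
    (hX : X ≤ 2 * (120 * 20000 ^ 5 / K ^ 5) + p ^ 2 + 6 * ((2 * K + 9) / θ) * h) :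
    X ≤ (240 * 20000 ^ 5 + 4 * C0 ^ 2 + 6 * (22 / c) * (20000 * 115 * (2 / c + 2 * C0))) / M ^ 15 := by
  have hM0 : 0 < M := by linarith
  subst hL hK hθ
  have hMp : 0 < M ^ 10 := by positivity
  have hb0 : 0 < b := by linarith
  have hib : 1 / b ≤ 2 / M ^ 10 := by
    rw [div_le_div_iff₀ hb0 hMp]; linarith
  have hp2 : p ≤ 2 * C0 / M ^ 10 := by
    calc p ≤ C0 * (1 / b) := by rw [mul_one_div]; exact hp
      _ ≤ C0 * (2 / M ^ 10) := by gcongr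
      _ = _ := by ring
  have hth : 1 / (c * b) ≤ 2 / c / M ^ 10 := by
    calc 1 / (c * b) = 1 / c * (1 / b) := by rw [one_div_mul_one_div]
      _ ≤ 1 / c * (2 / M ^ 10) := by gcongr
      _ = _ := by ring
  have hsum0 : 0 ≤ 1 / (c * b) + p := by positivity
  have hh2 : h ≤ 20000 * 115 * (2 / c + 2 * C0) * M / M ^ 10 := by
    calc h ≤ S * (1 / (c * b) + p) := hh
      _ ≤ 20000 * (115 * M) * (1 / (c * b) + p) := by gcongr
      _ ≤ 20000 * (115 * M) * (2 / c / M ^ 10 + 2 * C0 / M ^ 10) := by gcongr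
      _ = _ := by ring
  have hM3 : 1 ≤ M ^ 3 := one_le_pow₀ hM
  have hk : (2 * M ^ 3 + 9) / (c * b) ≤ 22 / c * M ^ 3 / M ^ 10 := by
    calc (2 * M ^ 3 + 9) / (c * b) = (2 * M ^ 3 + 9) * (1 / (c * b)) := by ring
      _ ≤ (11 * M ^ 3) * (2 / c / M ^ 10) := by
        gcongr
        linarith
      _ = _ := by ring
  have h3 : 6 * ((2 * M ^ 3 + 9) / (c * b)) * h ≤
      6 * (22 / c) * (20000 * 115 * (2 / c + 2 * C0)) / M ^ 15 := by
    have hA : 0 ≤ (2 * M ^ 3 + 9) / (c * b) := by positivity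
    calc 6 * ((2 * M ^ 3 + 9) / (c * b)) * h
        ≤ 6 * ((2 * M ^ 3 + 9) / (c * b)) * (20000 * 115 * (2 / c + 2 * C0) * M / M ^ 10) := by gcongr
      _ ≤ 6 * (22 / c * M ^ 3 / M ^ 10) * (20000 * 115 * (2 / c + 2 * C0) * M / M ^ 10) := by gcongr
      _ = 6 * (22 / c) * (20000 * 115 * (2 / c + 2 * C0)) / M ^ 16 := by
        field_simp
      _ ≤ _ := by
        gcongr
        norm_num
  have h2 : p ^ 2 ≤ 4 * C0 ^ 2 / M ^ 15 := by
    calc p ^ 2 ≤ (2 * C0 / M ^ 10) ^ 2 := by gcongr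
      _ = 4 * C0 ^ 2 / M ^ 20 := by rw [div_pow, ← pow_mul]; ring
      _ ≤ _ := by
        gcongr
        norm_num
  have h1 : 2 * (120 * 20000 ^ 5 / (M ^ 3) ^ 5) = 240 * 20000 ^ 5 / M ^ 15 := by
    rw [← pow_mul]; ring
  rw [h1] at hX
  rw [add_div, add_div]
  linarith

lemma Om_final : ∃ C : ℝ, 0 < C ∧ ∀ᶠ T : ℕ in atTop, ∀ t : ℕ,
    2 * (T : ℝ) / (Real.log T) ^ (10 : ℕ) < (t : ℝ) →
    (t : ℝ) < (T : ℝ) - 2 * (T : ℝ) / (Real.log T) ^ (10 : ℕ) →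
    ∀ N, ⌊(T : ℝ) / (Real.log T) ^ (10 : ℕ)⌋₊ ≤ N →
      Om t (T - t) ⌊(T : ℝ) / (Real.log T) ^ (10 : ℕ)⌋₊ N ≤ C / (Real.log T) ^ ((3 : ℝ) / 2) := by
  obtain ⟨c, hc, C0, hC0, r0, hbad⟩ := Gn_bad
  refine ⟨240 * 20000 ^ 5 + 4 * C0 ^ 2 + 6 * (22 / c) * (20000 * 115 * (2 / c + 2 * C0)),
    by positivity, ?_⟩
  have e1 : ∀ᶠ T : ℕ in atTop, (1 : ℝ) ≤ Real.log T :=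
    (Real.tendsto_log_atTop.comp tendsto_natCast_atTop_atTop).eventually_ge_atTop 1
  have e2 : ∀ᶠ T : ℕ in atTop, 2 * Real.log T ^ 10 ≤ Real.sqrt T := by
    have hlit : (fun x : ℝ => Real.log x ^ 10) =o[atTop] fun x => x ^ ((1 : ℝ) / 2) := by
      have := isLittleO_log_rpow_rpow_atTop (s := 1 / 2) (10 : ℝ) (by norm_num)
      refine this.congr' ?_ (by rfl)
      filter_upwards with x
      rw [← Real.rpow_natCast]; norm_num
    have h := hlit.bound (show (0 : ℝ) < 1 / 2 by norm_num)
    have h' := tendsto_natCast_atTop_atTop (R := ℝ) |>.eventually h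
    filter_upwards [h'] with T hT
    rw [Real.norm_eq_abs, Real.norm_eq_abs, ← Real.sqrt_eq_rpow, abs_of_nonneg (Real.sqrt_nonneg _)] at hT
    linarith [le_abs_self (Real.log T ^ 10)]
  have e3 : ∀ᶠ T : ℕ in atTop, (r0 : ℝ) + 1 ≤ Real.sqrt T :=
    (Real.tendsto_sqrt_atTop.comp tendsto_natCast_atTop_atTop).eventually_ge_atTop _
  filter_upwards [e1, e2, e3] with T h1 h2 h3 t ht1 ht2 N hN
  set L := Real.log T with hLdef
  set n := ⌊(T : ℝ) / L ^ (10 : ℕ)⌋₊ with hn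
  have hL0 : 0 < L := by linarith
  have hL10 : 1 ≤ L ^ 10 := one_le_pow₀ h1
  have hT0 : (0 : ℝ) ≤ T := Nat.cast_nonneg T
  have hs1 : 1 ≤ Real.sqrt T := by linarith [Nat.cast_nonneg (α := ℝ) r0]
  have hss : Real.sqrt T * Real.sqrt T = T := Real.mul_self_sqrt hT0
  have hT1 : (1 : ℝ) ≤ T := by nlinarith
  have hnle : (n : ℝ) ≤ T / L ^ 10 := Nat.floor_le (by positivity)
  have hngt : (T : ℝ) / L ^ 10 < n + 1 := Nat.lt_floor_add_one _
  have hTL : 2 * Real.sqrt T ≤ T / L ^ 10 := by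
    rw [le_div_iff₀ (by positivity)]
    nlinarith [Real.sqrt_nonneg (T : ℝ)]
  have hnlow : T / L ^ 10 / 2 ≤ n := by linarith
  have hnsq : Real.sqrt T ≤ n := by linarith
  have hnpos : (0 : ℝ) < n := by linarith
  have hnp : 0 < n := by exact_mod_cast hnpos
  have hnT : (n : ℝ) ≤ T := hnle.trans (div_le_self hT0 hL10)
  have hnr : r0 ≤ n := by
    have : (r0 : ℝ) ≤ n := by linarith
    exact_mod_cast this
  have hTLe : 2 * (T : ℝ) / L ^ 10 = 2 * (T / L ^ 10) := by ring
  rw [hTLe] at ht1 ht2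
  have htT : t ≤ T := by
    have : (t : ℝ) ≤ T := by linarith [Real.sqrt_nonneg (T : ℝ)]
    exact_mod_cast this
  have g1 : 2 * n ≤ t := by
    have : 2 * (n : ℝ) ≤ t := by linarith
    exact_mod_cast this
  have g2 : 2 * n ≤ T - t := by
    have : 2 * (n : ℝ) ≤ ((T - t : ℕ) : ℝ) := by rw [Nat.cast_sub htT]; linarith
    exact_mod_cast this
  have hb : L / 2 ≤ Real.log n := by
    calc L / 2 = Real.log (Real.sqrt T) := by rw [Real.log_sqrt hT0]
      _ ≤ Real.log n := Real.log_le_log (by linarith) hnsq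
  have hb0 : 0 < Real.log n := by linarith
  set M := L ^ ((1 : ℝ) / 10) with hMdef
  have hM : 1 ≤ M := Real.one_le_rpow h1 (by norm_num)
  have hLM : L = M ^ 10 := by
    rw [hMdef, ← Real.rpow_natCast, ← Real.rpow_mul hL0.le]; norm_num
  have hM15 : L ^ ((3 : ℝ) / 2) = M ^ 15 := by
    rw [hMdef, ← Real.rpow_natCast, ← Real.rpow_mul hL0.le]; norm_num
  rw [hM15]
  have hS : Sg n (N + n + n) (2 * T + 3 * n + n) ≤ 20000 * (115 * M) := by
    refine (Sg_le n _ _ hnp).trans ?_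
    have hl : Real.log ((n + (2 * T + 3 * n + n) : ℕ) : ℝ) ≤ Real.log (14 * L ^ 10 * n) := by
      apply Real.log_le_log
      · have : 0 < n + (2 * T + 3 * n + n) := by omega
        exact_mod_cast this
      · push_cast
        have : (T : ℝ) ≤ 2 * L ^ 10 * n := by
          have := hnlow
          rw [div_div, div_le_iff₀ (by positivity)] at this
          linarith
        linarith
    have hl2 : Real.log (14 * L ^ 10 * n) = Real.log 14 + 10 * Real.log L + Real.log n := by
      rw [Real.log_mul (by positivity) hnpos.ne', Real.log_mul (by norm_num) (by positivity), Real.log_pow]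
      norm_num
    have hl3 : Real.log 14 ≤ 14 := (Real.log_le_sub_one_of_pos (by norm_num)).trans (by norm_num)
    have hl4 : Real.log L ≤ 10 * M := by
      have := Real.log_le_rpow_div hL0.le (show (0 : ℝ) < 1 / 10 by norm_num)
      rw [← hMdef] at this
      linarith
    linarith
  have hp0 : 0 ≤ EE n (fun l => ind (Gn n l < c * Real.log n)) :=
    EE_nonneg fun l _ => by unfold ind; split_ifs <;> norm_num
  have hOm := Om_le (K := M ^ 3) (θ := c * Real.log n) (H := T) g1 g2 htT (Nat.sub_le _ _) hN
    (by positivity) (by positivity) rfl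
  exact final_arith hc hC0 hM hLM rfl hb rfl hp0 (hbad n hnr) hS
    (hh_le n (N + n) (2 * T + 3 * n) n _ (by positivity)) hOm

/-- Estimate (2.24): in `ℤ⁴`, for a doubly infinite walk `X¹` (given by independent
forward part `q.1.1` and backward part `q.1.2`) and an independent walk `X²` from `0`,
with `t' = ⌊T(log T)^{-10}⌋` and `2T(log T)^{-10} < t < T - 2T(log T)^{-10}`,
`P[X¹[-t,T-t] ∩ X²(0,t'] = ∅, X¹[-t,T-t] ∩ X²[t',∞) ≠ ∅] ≤ C (log T)^{-3/2}`. -/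
theorem four_dim_avoid_then_hit
    (Pw : Zd 4 → Measure (ℕ → Zd 4)) (hPw : IsSRWFamily 4 Pw) :
    ∃ C : ℝ, 0 < C ∧ ∀ᶠ T : ℕ in atTop, ∀ t : ℕ,
      2 * (T : ℝ) / (Real.log T) ^ (10 : ℕ) < (t : ℝ) →
      (t : ℝ) < (T : ℝ) - 2 * (T : ℝ) / (Real.log T) ^ (10 : ℕ) →
      ∀ Q : Measure (((ℕ → Zd 4) × (ℕ → Zd 4)) × (ℕ → Zd 4)),
        IsProbabilityMeasure Q →
        (∀ (A B E : Set (ℕ → Zd 4)), MeasurableSet A → MeasurableSet B →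
          MeasurableSet E → Q ((A ×ˢ B) ×ˢ E) = Pw 0 A * Pw 0 B * Pw 0 E) →
        (Q {q | (∀ z : Zd 4,
              ((∃ s ≤ t, q.1.2 s = z) ∨ (∃ s ≤ T - t, q.1.1 s = z)) →
                ∀ s : ℕ, 1 ≤ s → s ≤ ⌊(T : ℝ) / (Real.log T) ^ (10 : ℕ)⌋₊ →
                  q.2 s ≠ z) ∧
            ∃ z : Zd 4,
              ((∃ s ≤ t, q.1.2 s = z) ∨ (∃ s ≤ T - t, q.1.1 s = z)) ∧
                ∃ s : ℕ, ⌊(T : ℝ) / (Real.log T) ^ (10 : ℕ)⌋₊ ≤ s ∧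
                  q.2 s = z}).toReal ≤
          C / (Real.log T) ^ ((3 : ℝ) / 2) := by
  obtain ⟨C, hC, h⟩ := Om_final
  refine ⟨C, hC, ?_⟩
  filter_upwards [h] with T hT t ht1 ht2 Q _ hQ
  have hlog : 0 ≤ Real.log T := Real.log_natCast_nonneg T
  exact Q_event_le (hPw 0) Q hQ (by positivity) (hT t ht1 ht2)

end FRIPaper
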